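/- Let s = 1, R = R_1, Λ = R ⊗_K R^{op}, and let ⋯ → Q_t → ⋯ → Q_0 → R → 0 be the minimal projective resolution of R as a left Λ-module. For t ∈ ℕ write t = 11ℓ + r with 0 ≤ r ≤ 10. Then: if r = 0, dim_K Hom_Λ(Q_t, R) = 12 for ℓ even and 4 for ℓ odd; if r = 1, it is 7 for ℓ even and 5 for ℓ odd; if r ∈ {2,8}, it is 4; if r ∈ {3,5,7}, it is 8; if r = 4, it is 7 for ℓ even and 13 for ℓ odd; if r = 6, it is 13 for ℓ even and 7 for ℓ odd; if r = 9, it is 5 for ℓ even and 7 for ℓ odd; if r = 10, it is 4 for ℓ even and 12 for ℓ odd. -/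

import Mathlib

open scoped TensorProduct

set_option synthInstance.maxHeartbeats 1000000
set_option maxHeartbeats 2000000

universe u v

namespace E6

/-- Generators of the presentation of the path algebra of the quiver `𝒬ₛ`:
trivial paths `e i`, arrows `a i` (the `αᵢ`), `b i` (the `βᵢ`) and `g i` (the `γᵢ`). -/
inductive Gen (s : ℕ) : Type
  | e (i : ZMod (6 * s))
  | a (i : ZMod (3 * s))
  | b (i : ZMod (3 * s))
  | g (i : ZMod s)

variable (K : Type u) [Field K] (s : ℕ)

/-- The free algebra on the generators. -/
abbrev F : Type u := FreeAlgebra K (Gen s)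

/-- Trivial path generators. -/
noncomputable def E (i : ZMod (6 * s)) : F K s := FreeAlgebra.ι K (Gen.e i)
/-- `α` arrow generators. -/
noncomputable def A (i : ZMod (3 * s)) : F K s := FreeAlgebra.ι K (Gen.a i)
/-- `β` arrow generators. -/
noncomputable def B (i : ZMod (3 * s)) : F K s := FreeAlgebra.ι K (Gen.b i)
/-- `γ` arrow generators. -/
noncomputable def G (i : ZMod s) : F K s := FreeAlgebra.ι K (Gen.g i)

/-- Source vertex of the arrow `αᵢ` : writing `i = 3t + j` with `j < 3`,
`α_{3t} : 6t → 6t+1`, `α_{3t+1} : 6t+1 → 6t+2`, `α_{3t+2} : 6t+2 → 6t+5`. -/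
def aSrc (i : ZMod (3 * s)) : ZMod (6 * s) := ((2 * i.val - i.val % 3 : ℕ) : ZMod (6 * s))

/-- Target vertex of the arrow `αᵢ`. -/
def aTgt (i : ZMod (3 * s)) : ZMod (6 * s) :=
  if i.val % 3 = 1 then ((2 * i.val : ℕ) : ZMod (6 * s)) else ((2 * i.val + 1 : ℕ) : ZMod (6 * s))

/-- Source vertex of the arrow `βᵢ` : `β_{3t} : 6t → 6t+3`, `β_{3t+1} : 6t+3 → 6t+4`,
`β_{3t+2} : 6t+4 → 6t+5`. -/
def bSrc (i : ZMod (3 * s)) : ZMod (6 * s) :=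
  if i.val % 3 = 1 then ((2 * i.val + 1 : ℕ) : ZMod (6 * s)) else ((2 * i.val : ℕ) : ZMod (6 * s))

/-- Target vertex of the arrow `βᵢ`. -/
def bTgt (i : ZMod (3 * s)) : ZMod (6 * s) := ((2 * i.val + 3 - i.val % 3 : ℕ) : ZMod (6 * s))

/-- Source vertex of the arrow `γₜ : 6t+5 → 6t+6`. -/
def gSrc (i : ZMod s) : ZMod (6 * s) := ((6 * i.val + 5 : ℕ) : ZMod (6 * s))

/-- Target vertex of the arrow `γₜ`. -/
def gTgt (i : ZMod s) : ZMod (6 * s) := ((6 * i.val + 6 : ℕ) : ZMod (6 * s))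

/-- The set of arrow generators inside the free algebra. -/
noncomputable def arrows : Set (F K s) :=
  Set.range (A K s) ∪ Set.range (B K s) ∪ Set.range (G K s)

/-- The relations presenting `R_s = K[𝒬ₛ]/I₀` as a quotient of the free algebra on the
trivial paths and the arrows.  The first eight families of relations present the path
algebra `K[𝒬ₛ]` (the trivial paths are orthogonal idempotents summing to `1`, and each
arrow is fixed by multiplication with the trivial paths at its target, resp. source);
the remaining relations generate the ideal `I₀`: all paths of length `5` vanish
(equivalently, all products of five arrows), `α_{3t+2}α_{3t+1}α_{3t} = β_{3t+2}β_{3t+1}β_{3t}`,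
and `α_{3t+3}γ_tβ_{3t+2} = 0 = β_{3t+3}γ_tα_{3t+2}`. -/
inductive Rel : F K s → F K s → Prop
  | idem (i j : ZMod (6 * s)) :
      Rel (E K s i * E K s j) (if i = j then E K s i else 0)
  | sum_one :
      Rel (∑ i ∈ Finset.range (6 * s), E K s (i : ZMod (6 * s))) 1
  | a_tgt (i : ZMod (3 * s)) : Rel (E K s (aTgt s i) * A K s i) (A K s i)
  | a_src (i : ZMod (3 * s)) : Rel (A K s i * E K s (aSrc s i)) (A K s i)
  | b_tgt (i : ZMod (3 * s)) : Rel (E K s (bTgt s i) * B K s i) (B K s i)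
  | b_src (i : ZMod (3 * s)) : Rel (B K s i * E K s (bSrc s i)) (B K s i)
  | g_tgt (i : ZMod s) : Rel (E K s (gTgt s i) * G K s i) (G K s i)
  | g_src (i : ZMod s) : Rel (G K s i * E K s (gSrc s i)) (G K s i)
  | len5 (x₁ x₂ x₃ x₄ x₅ : F K s) (h₁ : x₁ ∈ arrows K s) (h₂ : x₂ ∈ arrows K s)
      (h₃ : x₃ ∈ arrows K s) (h₄ : x₄ ∈ arrows K s) (h₅ : x₅ ∈ arrows K s) :
      Rel (x₁ * x₂ * x₃ * x₄ * x₅) 0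
  | comm (t : Fin s) :
      Rel (A K s ((3 * (t : ℕ) + 2 : ℕ) : ZMod (3 * s)) *
             A K s ((3 * (t : ℕ) + 1 : ℕ) : ZMod (3 * s)) *
             A K s ((3 * (t : ℕ) : ℕ) : ZMod (3 * s)))
          (B K s ((3 * (t : ℕ) + 2 : ℕ) : ZMod (3 * s)) *
             B K s ((3 * (t : ℕ) + 1 : ℕ) : ZMod (3 * s)) *
             B K s ((3 * (t : ℕ) : ℕ) : ZMod (3 * s)))
  | zero_agb (t : Fin s) :
      Rel (A K s ((3 * (t : ℕ) + 3 : ℕ) : ZMod (3 * s)) * G K s (((t : ℕ) : ℕ) : ZMod s) *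
             B K s ((3 * (t : ℕ) + 2 : ℕ) : ZMod (3 * s))) 0
  | zero_bga (t : Fin s) :
      Rel (B K s ((3 * (t : ℕ) + 3 : ℕ) : ZMod (3 * s)) * G K s (((t : ℕ) : ℕ) : ZMod s) *
             A K s ((3 * (t : ℕ) + 2 : ℕ) : ZMod (3 * s))) 0

/-- The self-injective algebra `R_s` of tree class `E₆`, i.e. the quotient
`K[𝒬ₛ]/I₀` of the path algebra of `𝒬ₛ`, presented by generators and relations. -/
abbrev Alg : Type u := RingQuot (Rel K s)

/-- A canonical `Semiring` instance on `R_s`, routed through the `Ring` structure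
(this keeps instance paths on `R_s` coherent). -/
noncomputable instance (priority := 1100) : Semiring (Alg K s) :=
  Ring.toSemiring

/-- The images `e_i` in `R_s` of the trivial paths. -/
noncomputable def ee (i : ZMod (6 * s)) : Alg K s :=
  RingQuot.mkAlgHom K (Rel K s) (E K s i)

/-- The images `α_i` in `R_s` of the arrows `α`. -/
noncomputable def aa (i : ZMod (3 * s)) : Alg K s :=
  RingQuot.mkAlgHom K (Rel K s) (A K s i)

/-- The images `β_i` in `R_s` of the arrows `β`. -/
noncomputable def bb (i : ZMod (3 * s)) : Alg K s :=
  RingQuot.mkAlgHom K (Rel K s) (B K s i)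

/-- The images `γ_i` in `R_s` of the arrows `γ`. -/
noncomputable def gg (i : ZMod s) : Alg K s :=
  RingQuot.mkAlgHom K (Rel K s) (G K s i)

/-! ### The enveloping algebra `Λ = R ⊗ₖ Rᵐᵒᵖ` and the outer bimodule structure on `R` -/

/-- The enveloping algebra `Λ = R_s ⊗[K] R_sᵐᵒᵖ`. -/
abbrev Env : Type u := Alg K s ⊗[K] (Alg K s)ᵐᵒᵖ

/-- A canonical `Semiring` instance on `Λ`, routed through the `Ring` structure
(this keeps instance paths on `Λ` coherent). -/
noncomputable instance (priority := 1100) : Semiring (Env K s) :=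
  Ring.toSemiring

/-- `R_s` is a left `Λ`-module via the outer action `(a ⊗ b) • r = a * r * b.unop`. -/
noncomputable instance : Module (Env K s) (Alg K s) :=
  TensorProduct.Algebra.module


instance : SMulCommClass (Env K s) K (Alg K s) where
  smul_comm l k r := by
    induction l using TensorProduct.induction_on with
    | zero => simp
    | tmul a b =>
        show a • b • (k • r) = k • (a • b • r)
        rw [smul_comm b k r, smul_comm a k (b • r)]
    | add x y hx hy =>
        rw [add_smul, add_smul, smul_add, hx, hy]

instance : IsScalarTower K (Env K s) (Alg K s) where
  smul_assoc k l r := by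
    induction l using TensorProduct.induction_on with
    | zero => simp
    | tmul a b =>
        show ((k • a) ⊗ₜ[K] b) • r = k • (a ⊗ₜ[K] b) • r
        show (k • a) • b • r = k • (a • (b • r))
        rw [smul_assoc]
    | add x y hx hy =>
        rw [smul_add, add_smul, add_smul, hx, hy, smul_add]

/-! ### Projective and simple modules -/

/-- The quotient of a module by a submodule (as a type). -/
def modQuot {R : Type v} [Ring R] {M : Type*} [AddCommGroup M] [Module R M]
    (p : Submodule R M) : Type _ := M ⧸ p

noncomputable instance {R : Type v} [Ring R] {M : Type*} [AddCommGroup M] [Module R M]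
    (p : Submodule R M) : AddCommGroup (modQuot p) :=
  inferInstanceAs (AddCommGroup (M ⧸ p))

noncomputable instance {R : Type v} [Ring R] {M : Type*} [AddCommGroup M] [Module R M]
    (p : Submodule R M) : Module R (modQuot p) :=
  inferInstanceAs (Module R (M ⧸ p))

/-- Right multiplication by a fixed element, as an endomorphism of the left regular module. -/
def rmul (Λ : Type v) [Ring Λ] (x : Λ) : Λ →ₗ[Λ] Λ where
  toFun y := y * x
  map_add' a b := add_mul a b x
  map_smul' r a := mul_assoc r a x

/-- The Jacobson radical of the ring `Λ` times the `Λ`-module `M`, i.e. the submodule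
`rad(Λ)·M` generated by all products `r • x` with `r` in the Jacobson radical of `Λ`
(the Jacobson radical being the intersection of all maximal left ideals). -/
def radSMul (Λ : Type v) [Ring Λ] (M : Type w) [AddCommGroup M] [Module Λ M] :
    Submodule Λ M :=
  Submodule.span Λ {z | ∃ r ∈ (⊥ : Ideal Λ).jacobson, ∃ x : M, z = r • x}

/-- The indecomposable projective left `R_s`-module `P_i = R_s·e_i`. -/
noncomputable def P (i : ZMod (6 * s)) : Submodule (Alg K s) (Alg K s) :=
  LinearMap.range (rmul (Alg K s) (ee K s i))

/-- The simple left `R_s`-module `S_i = P_i / rad(P_i)` at the vertex `i`. -/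
noncomputable def S (i : ZMod (6 * s)) : Type u :=
  modQuot (radSMul (Alg K s) ↥(P K s i))

noncomputable instance (i : ZMod (6 * s)) : AddCommGroup (S K s i) :=
  inferInstanceAs (AddCommGroup (modQuot (radSMul (Alg K s) ↥(P K s i))))

noncomputable instance (i : ZMod (6 * s)) : Module (Alg K s) (S K s i) :=
  inferInstanceAs (Module (Alg K s) (modQuot (radSMul (Alg K s) ↥(P K s i))))

/-- The canonical projection `P_i → S_i`. -/
noncomputable def toS (i : ZMod (6 * s)) : ↥(P K s i) →ₗ[Alg K s] S K s i :=
  (radSMul (Alg K s) ↥(P K s i)).mkQ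

/-- Corestriction of right multiplication by `e_i` to `P_i`. -/
noncomputable def toP (i : ZMod (6 * s)) : Alg K s →ₗ[Alg K s] ↥(P K s i) :=
  LinearMap.codRestrict (P K s i) (rmul (Alg K s) (ee K s i))
    (fun c => LinearMap.mem_range_self _ c)

/-- The homomorphism `P_j → P_i` given by right multiplication with (the class of)
a path `w` from vertex `i` to vertex `j`; concretely it is `x ↦ x * w * e_i`, which
for an actual path `w` from `i` to `j` (so that `w * e_i = w` holds in `R_s`) is just
right multiplication `x ↦ x * w`. -/
noncomputable def pmul (i j : ZMod (6 * s)) (w : Alg K s) :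
    ↥(P K s j) →ₗ[Alg K s] ↥(P K s i) :=
  (toP K s i).comp ((rmul (Alg K s) w).comp (P K s j).subtype)

/-- `α`-arrows of `R_s`, indexed by natural numbers. -/
noncomputable def aN (k : ℕ) : Alg K s := aa K s ((k : ℕ) : ZMod (3 * s))

/-- `β`-arrows of `R_s`, indexed by natural numbers. -/
noncomputable def bN (k : ℕ) : Alg K s := bb K s ((k : ℕ) : ZMod (3 * s))

/-- `γ`-arrows of `R_s`, indexed by natural numbers. -/
noncomputable def gN (k : ℕ) : Alg K s := gg K s ((k : ℕ) : ZMod s)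

/-- The homomorphism `P_j → P_i` (vertices given by natural numbers, taken mod `6s`)
induced by right multiplication with `w`. -/
noncomputable def pmulN (i j : ℕ) (w : Alg K s) :
    ↥(P K s ((j : ℕ) : ZMod (6 * s))) →ₗ[Alg K s] ↥(P K s ((i : ℕ) : ZMod (6 * s))) :=
  pmul K s ((i : ℕ) : ZMod (6 * s)) ((j : ℕ) : ZMod (6 * s)) w

/-- The canonical projection `P_i → S_i` (vertex given by a natural number). -/
noncomputable def toSN (i : ℕ) :
    ↥(P K s ((i : ℕ) : ZMod (6 * s))) →ₗ[Alg K s] S K s ((i : ℕ) : ZMod (6 * s)) :=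
  toS K s ((i : ℕ) : ZMod (6 * s))

/-- The simple module `S_i`, for a vertex given by a natural number. -/
noncomputable def SN (i : ℕ) : Type u := S K s ((i : ℕ) : ZMod (6 * s))

noncomputable instance (i : ℕ) : AddCommGroup (SN K s i) :=
  inferInstanceAs (AddCommGroup (S K s ((i : ℕ) : ZMod (6 * s))))

noncomputable instance (i : ℕ) : Module (Alg K s) (SN K s i) :=
  inferInstanceAs (Module (Alg K s) (S K s ((i : ℕ) : ZMod (6 * s))))

/-! ### Projective resolutions, minimality and syzygies -/

/-- A projective resolution `⋯ → Q 1 → Q 0 → M → 0` of a module `M` over a ring `Λ`. -/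
structure ProjRes (Λ : Type v) [Ring Λ] (M : Type w) [AddCommGroup M] [Module Λ M] where
  /-- The terms of the resolution. -/
  Q : ℕ → Type v
  [acg : ∀ n, AddCommGroup (Q n)]
  [mod : ∀ n, Module Λ (Q n)]
  proj : ∀ n, Module.Projective Λ (Q n)
  /-- The differentials. -/
  d : ∀ n, Q (n + 1) →ₗ[Λ] Q n
  /-- The augmentation. -/
  ε : Q 0 →ₗ[Λ] M
  surj : Function.Surjective ε
  exact₀ : LinearMap.range (d 0) = LinearMap.ker ε
  exact : ∀ n, LinearMap.range (d (n + 1)) = LinearMap.ker (d n)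

attribute [instance] ProjRes.acg ProjRes.mod

/-- A projective resolution is minimal if the image of every differential lies in
`rad(Λ)` times the target. -/
def ProjRes.Minimal {Λ : Type v} [Ring Λ] {M : Type w} [AddCommGroup M]
    [Module Λ M] (res : ProjRes Λ M) : Prop :=
  ∀ n, LinearMap.range (res.d n) ≤ radSMul Λ (res.Q n)

/-- `Ω^p(M) ≅ N` : the `p`-th syzygy of `M` with respect to the projective resolution
`res` is isomorphic to `N` (stated for `p ≥ 1`; here `Ω¹ = ker ε` and
`Ω^p = ker (d (p-2))` for `p ≥ 2`). -/
def ProjRes.SyzygyIso {Λ : Type v} [Ring Λ] {M : Type w} [AddCommGroup M]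
    [Module Λ M] (res : ProjRes Λ M) (p : ℕ) (N : Type*) [AddCommGroup N]
    [Module Λ N] : Prop :=
  (p = 1 ∧ Nonempty (↥(LinearMap.ker res.ε) ≃ₗ[Λ] N)) ∨
  (2 ≤ p ∧ Nonempty (↥(LinearMap.ker (res.d (p - 2))) ≃ₗ[Λ] N))

/-! ### The automorphisms `σ` and `τ`, and twisted bimodules -/

/-- The defining property of the algebra automorphism `σ` of `R_s` :
`σ(e_i) = e_{i+36}` for `i ≡ 0,5 (mod 6)`, `σ(e_i) = e_{i+38}` for `i ≡ 1,2 (mod 6)`,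
`σ(e_i) = e_{i+34}` for `i ≡ 3,4 (mod 6)`; `σ(γ_i) = -γ_{i+6}`;
`σ(α_i) = -β_{i+18}` for `i ≡ 0,1 (mod 3)` and `σ(α_i) = β_{i+18}` for `i ≡ 2 (mod 3)`;
`σ(β_i) = -α_{i+18}` for `i ≡ 1,2 (mod 3)` and `σ(β_i) = α_{i+18}` for `i ≡ 0 (mod 3)`. -/
noncomputable def IsSigma (σ : Alg K s ≃ₐ[K] Alg K s) : Prop :=
  (∀ i : ZMod (6 * s), σ (ee K s i) =
      if i.val % 6 = 0 ∨ i.val % 6 = 5 then ee K s (i + 36)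
      else if i.val % 6 = 1 ∨ i.val % 6 = 2 then ee K s (i + 38)
      else ee K s (i + 34)) ∧
  (∀ i : ZMod s, σ (gg K s i) = -gg K s (i + 6)) ∧
  (∀ i : ZMod (3 * s), σ (aa K s i) =
      if i.val % 3 = 2 then bb K s (i + 18) else -bb K s (i + 18)) ∧
  (∀ i : ZMod (3 * s), σ (bb K s i) =
      if i.val % 3 = 0 then aa K s (i + 18) else -aa K s (i + 18))

/-- The underlying type of the twisted bimodule `₁R_σ` : the linear space `R_s` with
the ordinary left action of `R_s` and the right action twisted by `σ`. -/
def Twisted (_σ : Alg K s ≃ₐ[K] Alg K s) : Type u := Alg K s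

variable {K s} in
/-- The identity map `R_s → ₁R_σ`. -/
def Twisted.mk (σ : Alg K s ≃ₐ[K] Alg K s) (x : Alg K s) : Twisted K s σ := x

variable {K s} in
/-- The identity map `₁R_σ → R_s`. -/
def Twisted.un (σ : Alg K s ≃ₐ[K] Alg K s) (x : Twisted K s σ) : Alg K s := x

section TwistedInstances

variable (σ : Alg K s ≃ₐ[K] Alg K s)

noncomputable instance : AddCommGroup (Twisted K s σ) :=
  inferInstanceAs (AddCommGroup (Alg K s))

noncomputable instance : Module K (Twisted K s σ) :=
  inferInstanceAs (Module K (Alg K s))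

noncomputable instance : Module (Alg K s) (Twisted K s σ) :=
  inferInstanceAs (Module (Alg K s) (Alg K s))

/-- The right action on `₁R_σ` : `(op b) • m = m * σ(b)`. -/
noncomputable instance : Module (Alg K s)ᵐᵒᵖ (Twisted K s σ) :=
  Module.compHom (Alg K s) (RingHom.op (σ : Alg K s →+* Alg K s))

variable {K s σ} in
theorem Twisted.op_smul_def (b : (Alg K s)ᵐᵒᵖ) (m : Twisted K s σ) :
    b • m = Twisted.mk σ (Twisted.un σ m * σ b.unop) :=
  rfl

noncomputable instance : IsScalarTower K (Alg K s) (Twisted K s σ) :=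
  inferInstanceAs (IsScalarTower K (Alg K s) (Alg K s))

noncomputable instance : IsScalarTower K (Alg K s)ᵐᵒᵖ (Twisted K s σ) where
  smul_assoc k b m := by
    rw [Twisted.op_smul_def, Twisted.op_smul_def, MulOpposite.unop_smul, map_smul]
    show Twisted.un σ m * k • σ b.unop = k • (Twisted.un σ m * σ b.unop)
    rw [mul_smul_comm]

noncomputable instance : SMulCommClass (Alg K s) (Alg K s)ᵐᵒᵖ (Twisted K s σ) where
  smul_comm a b m := by
    rw [Twisted.op_smul_def]
    show Twisted.mk σ (a * (Twisted.un σ m * σ b.unop)) =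
      b • Twisted.mk σ (a * Twisted.un σ m)
    rw [Twisted.op_smul_def]
    show Twisted.mk σ (a * (Twisted.un σ m * σ b.unop)) =
      Twisted.mk σ ((a * Twisted.un σ m) * σ b.unop)
    rw [mul_assoc]

/-- The twisted bimodule `₁R_σ` as a module over the enveloping algebra `Λ`. -/
noncomputable instance : Module (Env K s) (Twisted K s σ) :=
  TensorProduct.Algebra.module

end TwistedInstances

/-- The defining property of the automorphism `τ` of `R_s` : `τ` fixes all `e_i`
and all `γ_i`, and `τ(α_i) = -α_i`, `τ(β_i) = -β_i` for `i ≡ 0,2 (mod 3)` while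
`τ(α_i) = α_i`, `τ(β_i) = β_i` for `i ≡ 1 (mod 3)`. -/
noncomputable def IsTau (τ : Alg K s ≃ₐ[K] Alg K s) : Prop :=
  (∀ i : ZMod (6 * s), τ (ee K s i) = ee K s i) ∧
  (∀ i : ZMod s, τ (gg K s i) = gg K s i) ∧
  (∀ i : ZMod (3 * s), τ (aa K s i) =
      if i.val % 3 = 1 then aa K s i else -aa K s i) ∧
  (∀ i : ZMod (3 * s), τ (bb K s i) =
      if i.val % 3 = 1 then bb K s i else -bb K s i)


/-- The dimensions of the groups `Hom_Λ(Q_t, R_1)` (`s = 1`), as stated. -/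
def homDim1 (t : ℕ) : ℕ :=
  let L := t / 11
  let r := t % 11
  let ev : Bool := L % 2 == 0
  if r == 0 then (if ev then 12 else 4)
  else if r == 1 then (if ev then 7 else 5)
  else if r == 2 || r == 8 then 4
  else if r == 3 || r == 5 || r == 7 then 8
  else if r == 4 then (if ev then 7 else 13)
  else if r == 6 then (if ev then 13 else 7)
  else if r == 9 then (if ev then 5 else 7)
  else (if ev then 4 else 12)

/-! ### Extension groups computed from a projective resolution -/

section Extension

variable {k : Type u} [Field k] {Γ : Type v} [Ring Γ] [Algebra k Γ]

section Precomposition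

variable {L M N : Type*} [AddCommGroup L] [Module Γ L] [AddCommGroup M] [Module Γ M]
  [AddCommGroup N] [Module Γ N] [Module k N] [IsScalarTower k Γ N]

variable (k N) in
/-- Precomposition with a `Γ`-linear map, as a `k`-linear map. -/
def precomp (f : L →ₗ[Γ] M) : (M →ₗ[Γ] N) →ₗ[k] (L →ₗ[Γ] N) where
  toFun g := g.comp f
  map_add' _ _ := rfl
  map_smul' _ _ := rfl

end Precomposition

variable {M : Type*} [AddCommGroup M] [Module Γ M] (res : ProjRes Γ M)
  (N : Type*) [AddCommGroup N] [Module Γ N] [Module k N] [IsScalarTower k Γ N]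

variable (k) in
/-- Cocycles of degree `t` with values in `N`. -/
def cocycles (t : ℕ) : Submodule k (res.Q t →ₗ[Γ] N) := LinearMap.ker (precomp k N (res.d t))

variable (k) in
/-- Coboundaries of degree `t` with values in `N`. -/
def coboundaries : (t : ℕ) → Submodule k (res.Q t →ₗ[Γ] N)
  | 0 => ⊥
  | t + 1 => LinearMap.range (precomp k N (res.d t))

variable (k) in
/-- The cohomology of `Hom_Γ(Q, N)`. -/
abbrev Cohomology (t : ℕ) : Type _ :=
  cocycles k res N t ⧸ (coboundaries k res N t).submoduleOf (cocycles k res N t)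

theorem ProjRes.d_comp_d (t : ℕ) (x : res.Q (t + 2)) : res.d t (res.d (t + 1) x) = 0 := by
  have : res.d (t + 1) x ∈ LinearMap.ker (res.d t) := by
    rw [← res.exact t]; exact LinearMap.mem_range_self _ x
  exact this

theorem ProjRes.ε_d (x : res.Q 1) : res.ε (res.d 0 x) = 0 := by
  have : res.d 0 x ∈ LinearMap.ker res.ε := by
    rw [← res.exact₀]; exact LinearMap.mem_range_self _ x
  exact this

variable {N} {N₁ N₂ : Type*} [AddCommGroup N₁] [Module Γ N₁] [Module k N₁] [IsScalarTower k Γ N₁]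
  [AddCommGroup N₂] [Module Γ N₂] [Module k N₂] [IsScalarTower k Γ N₂]

/-- Dimension shifting along a short exact sequence `0 → N₁ → N → N₂ → 0` whose middle term
has no cohomology in positive degrees. -/
theorem nonempty_cohomology_equiv_succ (i : N₁ →ₗ[Γ] N) (p : N →ₗ[Γ] N₂)
    (hi : Function.Injective i) (hp : Function.Surjective p)
    (hip : LinearMap.range i = LinearMap.ker p)
    (hacyc : ∀ t, cocycles k res N (t + 1) ≤ coboundaries k res N (t + 1))
    (hzero : ∀ f ∈ cocycles k res N 0, p.comp f = 0) (t : ℕ) :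
    Nonempty (Cohomology k res N₂ t ≃ₗ[k] Cohomology k res N₁ (t + 1)) := by
  have hpi : ∀ x, p (i x) = 0 := fun x => by
    have : i x ∈ LinearMap.ker p := by rw [← hip]; exact LinearMap.mem_range_self _ x
    exact this
  have hpmem : ∀ x, p x = 0 → x ∈ LinearMap.range i := fun x hx => by rw [hip]; exact hx
  let W : Submodule k (res.Q t →ₗ[Γ] N) :=
    { carrier := {F | ∀ x, p (F (res.d t x)) = 0}
      add_mem' := fun {a b} ha hb x => by simp [ha x, hb x]
      zero_mem' := fun x => by simp
      smul_mem' := fun c F hF x => by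
        change p (c • F (res.d t x)) = 0
        rw [LinearMap.map_smul_of_tower, hF x, smul_zero] }
  let e := LinearEquiv.ofInjective i hi
  have he : ∀ y, i (e.symm y) = y := fun y => by
    have := congrArg Subtype.val (e.apply_symm_apply y)
    exact this
  let low : W →ₗ[k] (res.Q (t + 1) →ₗ[Γ] N₁) :=
    { toFun := fun F => e.symm.toLinearMap.comp
        (LinearMap.codRestrict (LinearMap.range i) (F.1.comp (res.d t)) fun x => hpmem _ (F.2 x))
      map_add' := fun F G => by
        ext x
        apply hi
        simp only [LinearMap.comp_apply, LinearEquiv.coe_coe, LinearMap.add_apply, map_add, he]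
        rfl
      map_smul' := fun c F => by
        ext x
        apply hi
        simp only [LinearMap.comp_apply, LinearEquiv.coe_coe, LinearMap.smul_apply, he,
          LinearMap.map_smul_of_tower]
        rfl }
  have hlow : ∀ F x, i (low F x) = F.1 (res.d t x) := fun F x => he _
  let up : W →ₗ[k] cocycles k res N₂ t :=
    { toFun := fun F => ⟨p.comp F.1, by
        ext x; exact F.2 x⟩
      map_add' := fun F G => by
        ext x; exact map_add p _ _
      map_smul' := fun c F => by
        ext x; exact LinearMap.map_smul_of_tower p c (F.1 x) }
  let α : W →ₗ[k] Cohomology k res N₂ t := (Submodule.mkQ _).comp up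
  let β : W →ₗ[k] Cohomology k res N₁ (t + 1) :=
    (Submodule.mkQ _).comp
      (LinearMap.codRestrict (cocycles k res N₁ (t + 1)) low fun F => by
        ext x
        apply hi
        change i (low F (res.d (t + 1) x)) = i 0
        rw [hlow, res.d_comp_d]; simp)
  have hαs : Function.Surjective α := by
    intro y
    obtain ⟨⟨g, hg⟩, rfl⟩ := Submodule.mkQ_surjective _ y
    have := res.proj t
    obtain ⟨F, hF⟩ := Module.projective_lifting_property p g hp
    refine ⟨⟨F, fun x => ?_⟩, ?_⟩
    · have h1 := LinearMap.congr_fun hF (res.d t x)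
      have h2 := LinearMap.congr_fun hg x
      exact h1.trans h2
    · exact congrArg (Submodule.mkQ _) (Subtype.ext hF)
  have hβs : Function.Surjective β := by
    intro y
    obtain ⟨⟨g, hg⟩, rfl⟩ := Submodule.mkQ_surjective _ y
    have h1 : i.comp g ∈ cocycles k res N (t + 1) := by
      ext x
      have h2 := LinearMap.congr_fun hg x
      change i (g (res.d (t + 1) x)) = 0
      have h3 : g (res.d (t + 1) x) = 0 := h2
      rw [h3, map_zero]
    obtain ⟨F, hF⟩ := hacyc t h1
    have hF' : ∀ x, F (res.d t x) = i (g x) := fun x => LinearMap.congr_fun hF x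
    refine ⟨⟨F, fun x => by rw [hF', hpi]⟩, ?_⟩
    refine congrArg (Submodule.mkQ _) (Subtype.ext ?_)
    ext x
    apply hi
    exact (hlow _ x).trans (hF' x)
  have hαk : ∀ F : W, α F = 0 ↔ p.comp F.1 ∈ coboundaries k res N₂ t := fun F =>
    Submodule.Quotient.mk_eq_zero _
  have hβk : ∀ F : W, β F = 0 ↔ ∃ H : res.Q t →ₗ[Γ] N₁,
      ∀ x, i (H (res.d t x)) = F.1 (res.d t x) := by
    intro F
    refine (Submodule.Quotient.mk_eq_zero _).trans ?_
    constructor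
    · rintro ⟨H, hH⟩
      refine ⟨H, fun x => ?_⟩
      have := LinearMap.congr_fun hH x
      rw [← hlow F x]
      exact congrArg i this
    · rintro ⟨H, hH⟩
      refine ⟨H, ?_⟩
      ext x
      apply hi
      exact (hH x).trans (hlow F x).symm
  have hker : LinearMap.ker α = LinearMap.ker β := by
    ext F
    rw [LinearMap.mem_ker, LinearMap.mem_ker, hαk, hβk]
    have key : ∀ G : res.Q t →ₗ[Γ] N, (∀ x, G (res.d t x) = 0) → p.comp G = p.comp F.1 →
        ∃ H : res.Q t →ₗ[Γ] N₁, ∀ x, i (H (res.d t x)) = F.1 (res.d t x) := by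
      intro G hG hGF
      have hmem : ∀ x, (F.1 - G) x ∈ LinearMap.range i := fun x => by
        apply hpmem
        have := LinearMap.congr_fun hGF x
        have h' : p (G x) = p (F.1 x) := this
        rw [LinearMap.sub_apply, map_sub, h', sub_self]
      refine ⟨e.symm.toLinearMap.comp (LinearMap.codRestrict (LinearMap.range i) (F.1 - G) hmem),
        fun x => ?_⟩
      refine (he _).trans ?_
      change (F.1 - G) (res.d t x) = _
      rw [LinearMap.sub_apply, hG, sub_zero]
    have key' : ∀ H : res.Q t →ₗ[Γ] N₁, (∀ x, i (H (res.d t x)) = F.1 (res.d t x)) →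
        F.1 - i.comp H ∈ cocycles k res N t := by
      intro H hH
      ext x
      change F.1 (res.d t x) - i (H (res.d t x)) = 0
      rw [hH, sub_self]
    have hcomp : ∀ H : res.Q t →ₗ[Γ] N₁, p.comp (F.1 - i.comp H) = p.comp F.1 := by
      intro H
      ext x
      simp [hpi]
    cases t with
    | zero =>
      constructor
      · intro h
        exact key 0 (fun x => rfl) (by rw [LinearMap.comp_zero]; exact h.symm)
      · rintro ⟨H, hH⟩
        have := hzero _ (key' H hH)
        rw [hcomp] at this
        exact this
    | succ t =>
      constructor
      · rintro ⟨G, hG⟩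
        have := res.proj t
        obtain ⟨G', hG'⟩ := Module.projective_lifting_property p G hp
        refine key (G'.comp (res.d t)) (fun x => ?_) ?_
        · change G' (res.d t (res.d (t + 1) x)) = 0
          rw [res.d_comp_d, map_zero]
        · rw [← LinearMap.comp_assoc, hG']; exact hG
      · rintro ⟨H, hH⟩
        obtain ⟨G, hG⟩ := hacyc t (key' H hH)
        refine ⟨p.comp G, ?_⟩
        rw [← hcomp H, ← hG]
        rfl
  exact ⟨(α.quotKerEquivOfSurjective hαs).symm ≪≫ₗ Submodule.quotEquivOfEq _ _ hker ≪≫ₗ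
    β.quotKerEquivOfSurjective hβs⟩

/-- If the resolution is minimal and the radical acts trivially on `N`, then the cohomology
with values in `N` is the whole of `Hom_Γ(Q, N)`. -/
theorem nonempty_cohomology_equiv_hom (hmin : res.Minimal)
    (hN : ∀ r ∈ (⊥ : Ideal Γ).jacobson, ∀ x : N, r • x = 0) (t : ℕ) :
    Nonempty (Cohomology k res N t ≃ₗ[k] (res.Q t →ₗ[Γ] N)) := by
  have hd : ∀ t, ∀ f : res.Q t →ₗ[Γ] N, f.comp (res.d t) = 0 := by
    intro t f
    ext x
    have h1 : radSMul Γ (res.Q t) ≤ LinearMap.ker f := by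
      refine Submodule.span_le.2 ?_
      rintro _ ⟨r, hr, y, rfl⟩
      change f (r • y) = 0
      rw [map_smul, hN r hr]
    exact h1 (hmin t (LinearMap.mem_range_self _ x))
  have hZ : cocycles k res N t = ⊤ := by
    rw [eq_top_iff]
    intro f _
    exact hd t f
  have hB : coboundaries k res N t = ⊥ := by
    cases t with
    | zero => rfl
    | succ t =>
      rw [eq_bot_iff]
      rintro _ ⟨f, rfl⟩
      exact hd t f
  refine ⟨(Submodule.quotEquivOfEqBot _ ?_) ≪≫ₗ LinearEquiv.ofTop _ hZ⟩
  rw [hB, Submodule.submoduleOf, Submodule.comap_bot]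
  exact LinearMap.ker_eq_bot.2 Subtype.val_injective

end Extension

/-! ### Dual bimodules attached to a character -/

universe w

section DualBimodule

variable {K : Type u} [Field K] {A : Type u} [Ring A] [Algebra K A]

/-- The space of `K`-linear functionals on a left `A`-module `X`, on which `A` acts from the left
through the character `ε` and from the right by translation. -/
def Dual (_ε : A →ₐ[K] K) (X : Type*) [AddCommGroup X] [Module K X] : Type _ := X →ₗ[K] K

namespace Dual

variable (ε : A →ₐ[K] K)

section Basic

variable (X : Type*) [AddCommGroup X] [Module K X]

noncomputable instance : AddCommGroup (Dual ε X) := inferInstanceAs (AddCommGroup (X →ₗ[K] K))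

noncomputable instance : Module K (Dual ε X) := inferInstanceAs (Module K (X →ₗ[K] K))

instance : FunLike (Dual ε X) X K := inferInstanceAs (FunLike (X →ₗ[K] K) X K)

instance : LinearMapClass (Dual ε X) K X K := inferInstanceAs (LinearMapClass (X →ₗ[K] K) K X K)

variable {ε X}

@[ext]
theorem ext {f g : Dual ε X} (h : ∀ x, f x = g x) : f = g := LinearMap.ext h

@[simp] theorem add_apply (f g : Dual ε X) (x : X) : (f + g) x = f x + g x := rfl
@[simp] theorem sub_apply (f g : Dual ε X) (x : X) : (f - g) x = f x - g x := rfl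
@[simp] theorem smul_apply (c : K) (f : Dual ε X) (x : X) : (c • f) x = c * f x := rfl

end Basic

variable (X : Type*) [AddCommGroup X] [Module K X] [Module A X] [IsScalarTower K A X]

/-- The right action of `A` on functionals. -/
noncomputable def rightAction : Aᵐᵒᵖ →ₐ[K] Module.End K (X →ₗ[K] K) :=
  AlgHom.ofLinearMap
    { toFun := fun b => LinearMap.lcomp K K (Algebra.lsmul K K X b.unop)
      map_add' := fun b c => by ext f x; simp
      map_smul' := fun c b => by ext f x; simp }
    (by ext f x; simp) (fun b c => by ext f x; simp)

/-- The action of the enveloping algebra on `Dual ε X`. -/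
noncomputable def action : A ⊗[K] Aᵐᵒᵖ →ₐ[K] Module.End K (X →ₗ[K] K) :=
  Algebra.TensorProduct.lift ((Algebra.ofId K _).comp ε) (rightAction X)
    fun a b => Algebra.commutes (ε a) (rightAction X b)

noncomputable instance : Module (A ⊗[K] Aᵐᵒᵖ) (Dual ε X) :=
  Module.compHom (X →ₗ[K] K) (action ε X).toRingHom

variable {X}

theorem tmul_smul_apply (a : A) (b : Aᵐᵒᵖ) (f : Dual ε X) (x : X) :
    ((a ⊗ₜ[K] b) • f) x = ε a * f (b.unop • x) := by
  change (action ε X (a ⊗ₜ[K] b)) f x = _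
  rw [show action ε X (a ⊗ₜ[K] b) = _ from Algebra.TensorProduct.lift_tmul _ _ _ _ _]
  rfl

instance : IsScalarTower K (A ⊗[K] Aᵐᵒᵖ) (Dual ε X) where
  smul_assoc c l f := by
    change action ε X (c • l) f = c • action ε X l f
    rw [map_smul]; rfl

variable {Y : Type*} [AddCommGroup Y] [Module K Y] [Module A Y] [IsScalarTower K A Y]

/-- An additive map into a dual bimodule is linear as soon as it is compatible with pure
tensors. -/
def mkLinear {Q : Type*} [AddCommGroup Q] [Module (A ⊗[K] Aᵐᵒᵖ) Q] (F : Q → Dual ε X)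
    (hadd : ∀ p q, F (p + q) = F p + F q)
    (hsmul : ∀ (a : A) (b : A) q x, F ((a ⊗ₜ[K] MulOpposite.op b) • q) x = ε a * F q (b • x)) :
    Q →ₗ[A ⊗[K] Aᵐᵒᵖ] Dual ε X where
  toFun := F
  map_add' := hadd
  map_smul' l q := by
    have h0 : F 0 = 0 := by simpa using hadd 0 0
    induction l using TensorProduct.induction_on with
    | zero =>
      exact (congrArg F (zero_smul (A ⊗[K] Aᵐᵒᵖ) q)).trans
        (h0.trans (zero_smul (A ⊗[K] Aᵐᵒᵖ) (F q)).symm)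
    | tmul a b =>
      ext x
      rw [RingHom.id_apply, tmul_smul_apply]
      exact hsmul a b.unop q x
    | add l m hl hm => rw [add_smul, hadd, hl, hm, RingHom.id_apply, RingHom.id_apply,
        RingHom.id_apply, add_smul]

/-- The transpose of a linear map. -/
noncomputable def map (i : X →ₗ[A] Y) : Dual ε Y →ₗ[A ⊗[K] Aᵐᵒᵖ] Dual ε X :=
  mkLinear ε (fun f => LinearMap.comp (f : Y →ₗ[K] K) (i.restrictScalars K))
    (fun _ _ => rfl) (fun a b f x => by
      change ((a ⊗ₜ[K] MulOpposite.op b) • f) (i x) = ε a * f (i (b • x))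
      rw [tmul_smul_apply, MulOpposite.unop_op, i.map_smul])

variable (X) in
/-- The functionals on `X` on which `A` acts through the character `ε`. -/
def semiInv : Submodule K (X →ₗ[K] K) where
  carrier := {f | ∀ (a : A) x, f (a • x) = ε a * f x}
  add_mem' := fun {f g} hf hg a x => by
    rw [LinearMap.add_apply, LinearMap.add_apply, hf a x, hg a x, mul_add]
  zero_mem' := fun a x => by simp
  smul_mem' := fun c f hf a x => by
    rw [LinearMap.smul_apply, LinearMap.smul_apply, hf a x, smul_eq_mul, smul_eq_mul]; ring

end Dual

attribute [local instance] TensorProduct.Algebra.module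

theorem env_tmul_smul (a : A) (b : Aᵐᵒᵖ) (x : A) : (a ⊗ₜ[K] b) • x = a * (x * b.unop) := rfl

variable (res : ProjRes (A ⊗[K] Aᵐᵒᵖ) A) (ε : A →ₐ[K] K)
variable {X : Type*} [AddCommGroup X] [Module K X] [Module A X] [IsScalarTower K A X]

theorem ProjRes.ε_tmul_smul (a b : A) (q : res.Q 0) :
    res.ε ((a ⊗ₜ[K] MulOpposite.op b) • q) = a * (res.ε q * b) := by
  rw [map_smul, env_tmul_smul]; rfl

/-- The cocycle attached to a semi-invariant functional. -/
noncomputable def semiInvCocycle (φ : Dual.semiInv ε X) : res.Q 0 →ₗ[A ⊗[K] Aᵐᵒᵖ] Dual ε X :=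
  Dual.mkLinear ε (fun q => (ε (res.ε q) • (φ : X →ₗ[K] K) : X →ₗ[K] K))
    (fun p q => by rw [map_add, map_add, add_smul]; rfl)
    (fun a b q x => by
      change ε (res.ε _) * φ.1 x = ε a * (ε (res.ε q) * φ.1 (b • x))
      rw [res.ε_tmul_smul, map_mul, map_mul, φ.2 b x]; ring)

theorem semiInvCocycle_apply (φ : Dual.semiInv ε X) (q : res.Q 0) (x : X) :
    semiInvCocycle res ε φ q x = ε (res.ε q) * φ.1 x := rfl

theorem exists_semiInvCocycle_eq (f : res.Q 0 →ₗ[A ⊗[K] Aᵐᵒᵖ] Dual ε X)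
    (hf : f ∈ cocycles K res (Dual ε X) 0) : ∃ φ, semiInvCocycle res ε φ = f := by
  obtain ⟨q₀, hq₀⟩ := res.surj 1
  have hker : ∀ p q, res.ε p = res.ε q → f p = f q := by
    intro p q h
    have h1 : p - q ∈ LinearMap.range (res.d 0) := by
      rw [res.exact₀, LinearMap.mem_ker, map_sub, h, sub_self]
    obtain ⟨y, hy⟩ := h1
    have h2 : f (res.d 0 y) = 0 := LinearMap.congr_fun hf y
    rw [hy, map_sub] at h2
    exact sub_eq_zero.1 h2
  have hl : ∀ q x, f q x = ε (res.ε q) * f q₀ x := by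
    intro q x
    rw [hker q ((res.ε q ⊗ₜ[K] MulOpposite.op (1 : A)) • q₀) (by rw [res.ε_tmul_smul, hq₀]; simp),
      map_smul, Dual.tmul_smul_apply]
    simp
  refine ⟨⟨f q₀, fun a x => ?_⟩, ?_⟩
  · have h1 : f (((1 : A) ⊗ₜ[K] MulOpposite.op a) • q₀) x =
        f ((a ⊗ₜ[K] MulOpposite.op (1 : A)) • q₀) x := by
      rw [hker _ _]
      rw [res.ε_tmul_smul, res.ε_tmul_smul, hq₀]; simp
    rw [map_smul, map_smul, Dual.tmul_smul_apply, Dual.tmul_smul_apply] at h1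
    simp only [map_one, one_mul, MulOpposite.unop_op, one_smul] at h1
    exact h1
  · ext q x
    exact (hl q x).symm

theorem nonempty_cohomology_zero_equiv :
    Nonempty (Cohomology K res (Dual ε X) 0 ≃ₗ[K] Dual.semiInv ε X) := by
  have hc : ∀ φ, semiInvCocycle res ε φ ∈ cocycles K res (Dual ε X) 0 := fun φ => by
    ext q x
    change semiInvCocycle res ε φ (res.d 0 q) x = 0
    rw [semiInvCocycle_apply, res.ε_d, map_zero, zero_mul]
  let g : Dual.semiInv ε X →ₗ[K] cocycles K res (Dual ε X) 0 :=
    { toFun := fun φ => ⟨semiInvCocycle res ε φ, hc φ⟩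
      map_add' := fun φ ψ => by
        ext q x; exact mul_add _ _ _
      map_smul' := fun c φ => by
        ext q x; exact mul_left_comm _ _ _ }
  have hg : Function.Bijective g := by
    constructor
    · intro φ ψ h
      obtain ⟨q₀, hq₀⟩ := res.surj 1
      ext x
      have h1 : semiInvCocycle res ε φ q₀ x = semiInvCocycle res ε ψ q₀ x :=
        congrArg (fun f : cocycles K res (Dual ε X) 0 => f.1 q₀ x) h
      simpa [semiInvCocycle_apply, hq₀] using h1
    · rintro ⟨f, hf⟩
      obtain ⟨φ, hφ⟩ := exists_semiInvCocycle_eq res ε f hf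
      exact ⟨φ, Subtype.ext hφ⟩
  refine ⟨(Submodule.quotEquivOfEqBot _ ?_) ≪≫ₗ (LinearEquiv.ofBijective g hg).symm⟩
  rw [coboundaries, Submodule.submoduleOf, Submodule.comap_bot]
  exact LinearMap.ker_eq_bot.2 Subtype.val_injective

/-- Projectivity descends along restriction of scalars to a subring over which the ring
is free. -/
theorem projective_of_free_scalars {R S Q : Type*} [Ring R] [Ring S] [Module R S]
    [Module.Free R S] [AddCommGroup Q] [Module R Q] [Module S Q] [IsScalarTower R S Q]
    [IsScalarTower R S S] [Module.Projective S Q] : Module.Projective R Q := by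
  obtain ⟨s, hs⟩ := Module.projective_def'.1 ‹Module.Projective S Q›
  refine Module.Projective.of_split (s.restrictScalars R)
    ((Finsupp.linearCombination S id).restrictScalars R) ?_
  ext q
  exact LinearMap.congr_fun hs q

/-- The resolution is contractible as a complex of left `A`-modules. -/
theorem exists_left_splitting (t : ℕ) :
    ∃ σ : res.Q t →+ res.Q (t + 1),
      (∀ (a : A) q, σ ((a ⊗ₜ[K] (1 : Aᵐᵒᵖ)) • q) = (a ⊗ₜ[K] (1 : Aᵐᵒᵖ)) • σ q) ∧
      ∀ q, res.d t (σ (res.d t q)) = res.d t q := by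
  let ι : A →+* A ⊗[K] Aᵐᵒᵖ := Algebra.TensorProduct.includeLeftRingHom
  let _ : ∀ t, Module A (res.Q t) := fun t => Module.compHom (res.Q t) ι
  have hsm : ∀ t (a : A) (q : res.Q t), a • q = (a ⊗ₜ[K] (1 : Aᵐᵒᵖ)) • q := fun _ _ _ => rfl
  have : ∀ t, IsScalarTower A (A ⊗[K] Aᵐᵒᵖ) (res.Q t) := fun t => ⟨fun a l q => by
    rw [hsm, smul_smul]
    congr 1
    induction l using TensorProduct.induction_on with
    | zero => simp
    | tmul b c => rw [TensorProduct.smul_tmul', Algebra.TensorProduct.tmul_mul_tmul, one_mul]; rfl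
    | add x y hx hy => rw [smul_add, hx, hy, mul_add]⟩
  have : IsScalarTower A (A ⊗[K] Aᵐᵒᵖ) (A ⊗[K] Aᵐᵒᵖ) := inferInstance
  have : Module.Free A (A ⊗[K] Aᵐᵒᵖ) := inferInstance
  have hproj : ∀ t, Module.Projective A (res.Q t) := fun t =>
    have := res.proj t
    projective_of_free_scalars (S := A ⊗[K] Aᵐᵒᵖ)
  let D : ∀ t, res.Q (t + 1) →ₗ[A] res.Q t := fun t => (res.d t).restrictScalars A
  let η : res.Q 0 →ₗ[A] A :=
    { toFun := res.ε
      map_add' := map_add _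
      map_smul' := fun a q => by
        rw [hsm]
        refine (res.ε_tmul_smul a 1 q).trans ?_
        simp }
  have lift : ∀ t (h : res.Q t →ₗ[A] res.Q t), (∀ x, h x ∈ LinearMap.range (D t)) →
      ∃ σ : res.Q t →ₗ[A] res.Q (t + 1), ∀ x, D t (σ x) = h x := by
    intro t h hh
    have := hproj t
    obtain ⟨σ, hσ⟩ := Module.projective_lifting_property (D t).rangeRestrict
      (h.codRestrict _ hh) (D t).surjective_rangeRestrict
    exact ⟨σ, fun x => congrArg Subtype.val (LinearMap.congr_fun hσ x)⟩
  suffices H : ∃ σ : res.Q t →ₗ[A] res.Q (t + 1), ∀ q, D t (σ (D t q)) = D t q by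
    obtain ⟨σ, hσ⟩ := H
    exact ⟨σ.toAddMonoidHom, fun a q => σ.map_smul a q, hσ⟩
  induction t with
  | zero =>
    obtain ⟨τ, hτ⟩ := Module.projective_lifting_property η LinearMap.id res.surj
    have hτ' : ∀ a, res.ε (τ a) = a := fun a => LinearMap.congr_fun hτ a
    obtain ⟨σ, hσ⟩ := lift 0 (LinearMap.id - τ.comp η) (fun x => by
      have : x - τ (res.ε x) ∈ LinearMap.range (res.d 0) := by
        rw [res.exact₀, LinearMap.mem_ker, map_sub, hτ', sub_self]
      exact this)
    refine ⟨σ, fun q => ?_⟩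
    rw [hσ]
    change res.d 0 q - τ (res.ε (res.d 0 q)) = res.d 0 q
    rw [res.ε_d, map_zero, sub_zero]
  | succ t ih =>
    obtain ⟨τ, hτ⟩ := ih
    obtain ⟨σ, hσ⟩ := lift (t + 1) (LinearMap.id - τ.comp (D t)) (fun x => by
      have : x - τ (D t x) ∈ LinearMap.range (res.d (t + 1)) := by
        rw [res.exact t, LinearMap.mem_ker, map_sub]
        exact sub_eq_zero.2 (hτ x).symm
      exact this)
    refine ⟨σ, fun q => ?_⟩
    rw [hσ]
    change res.d (t + 1) q - τ (res.d t (res.d (t + 1) q)) = res.d (t + 1) q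
    rw [res.d_comp_d, map_zero, sub_zero]

/-- The dual of a finitely generated projective module has no cohomology in positive degrees. -/
theorem cocycles_dual_le_coboundaries {ι : Type*} [Fintype ι] (c : ι → X →ₗ[A] A) (u : ι → X)
    (hcu : ∀ x, ∑ l, c l x • u l = x) (t : ℕ) :
    cocycles K res (Dual ε X) (t + 1) ≤ coboundaries K res (Dual ε X) (t + 1) := by
  intro g hg
  have hg' : ∀ x, g (res.d (t + 1) x) = 0 := fun x => LinearMap.congr_fun hg x
  obtain ⟨σ, hσ, hd⟩ := exists_left_splitting res t
  have hgs : ∀ x, g (σ (res.d t x)) = g x := by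
    intro x
    have : σ (res.d t x) - x ∈ LinearMap.range (res.d (t + 1)) := by
      rw [res.exact t, LinearMap.mem_ker, map_sub, hd, sub_self]
    obtain ⟨y, hy⟩ := this
    have h := hg' y
    rw [hy, map_sub] at h
    exact sub_eq_zero.1 h
  let r : A → res.Q t → res.Q t := fun b q => (1 ⊗ₜ[K] MulOpposite.op b : A ⊗[K] Aᵐᵒᵖ) • q
  have hr_add : ∀ b b' q, r (b + b') q = r b q + r b' q := fun b b' q => by
    simp only [r, MulOpposite.op_add, TensorProduct.tmul_add, add_smul]
  have hr_smul : ∀ (k : K) b q, r (k • b) q = ((algebraMap K A k) ⊗ₜ[K] (1 : Aᵐᵒᵖ)) • r b q := by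
    intro k b q
    simp only [r, smul_smul, Algebra.TensorProduct.tmul_mul_tmul, one_mul, mul_one,
      MulOpposite.op_smul, Algebra.algebraMap_eq_smul_one, TensorProduct.tmul_smul,
      TensorProduct.smul_tmul']
  let G : res.Q t → Dual ε X := fun q =>
    ({ toFun := fun x => ∑ l, g (σ (r (c l x) q)) (u l)
       map_add' := fun x y => by
        simp only [map_add, hr_add, Dual.add_apply, Finset.sum_add_distrib]
       map_smul' := fun k x => by
        rw [RingHom.id_apply, smul_eq_mul, Finset.mul_sum]
        refine Finset.sum_congr rfl fun l _ => ?_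
        rw [LinearMap.map_smul_of_tower, hr_smul, hσ, map_smul, Dual.tmul_smul_apply]
        simp } : X →ₗ[K] K)
  have hG : ∀ q x, G q x = ∑ l, g (σ (r (c l x) q)) (u l) := fun _ _ => rfl
  refine ⟨Dual.mkLinear ε G (fun p q => ?_) (fun a b q x => ?_), ?_⟩
  · ext x
    simp only [Dual.add_apply, hG, r, smul_add, map_add, Finset.sum_add_distrib]
  · rw [hG, hG, Finset.mul_sum]
    refine Finset.sum_congr rfl fun l _ => ?_
    have h1 : r (c l x) ((a ⊗ₜ[K] MulOpposite.op b) • q) =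
        (a ⊗ₜ[K] (1 : Aᵐᵒᵖ)) • r (c l (b • x)) q := by
      simp only [r, smul_smul, Algebra.TensorProduct.tmul_mul_tmul, one_mul, mul_one, map_smul,
        smul_eq_mul, MulOpposite.op_mul]
    rw [h1, hσ, map_smul, Dual.tmul_smul_apply]
    simp
  · ext q x
    change ∑ l, g (σ (r (c l x) (res.d t q))) (u l) = g q x
    calc _ = ∑ l, g q (c l x • u l) := by
          refine Finset.sum_congr rfl fun l _ => ?_
          have h1 : r (c l x) (res.d t q) =
              res.d t ((1 ⊗ₜ[K] MulOpposite.op (c l x) : A ⊗[K] Aᵐᵒᵖ) • q) := by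
            rw [map_smul]
          rw [h1, hgs, map_smul, Dual.tmul_smul_apply]
          simp
      _ = g q x := by rw [← map_sum, hcu]

/-- The cohomology of the dual of a module resolved by finitely generated projectives `P k`, on
whose differentials semi-invariant functionals vanish. -/
theorem nonempty_cohomology_equiv_semiInv {P : ℕ → Type w} [∀ k, AddCommGroup (P k)]
    [∀ k, Module K (P k)] [∀ k, Module A (P k)] [∀ k, IsScalarTower K A (P k)]
    (d : ∀ k, P (k + 1) →ₗ[A] P k) (hd : ∀ k, LinearMap.range (d (k + 1)) = LinearMap.ker (d k))
    {ι : Type*} [Fintype ι] (c : ∀ k, ι → P k →ₗ[A] A) (u : ∀ k, ι → P k)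
    (hcu : ∀ k x, ∑ l, c k l x • u k l = x)
    (hsemi : ∀ k, ∀ φ ∈ Dual.semiInv ε (P k), ∀ x, φ (d k x) = 0) (t : ℕ) :
    ∀ (k n : ℕ) (_ : n = k + t) {Y : Type w} [AddCommGroup Y] [Module K Y] [Module A Y]
      [IsScalarTower K A Y] (π : P k →ₗ[A] Y) (_ : Function.Surjective π)
      (_ : LinearMap.ker π = LinearMap.range (d k)),
      Nonempty (Cohomology K res (Dual ε Y) t ≃ₗ[K] Dual.semiInv ε (P n)) := by
  induction t with
  | zero =>
    intro k n hn Y _ _ _ _ π hπ hker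
    obtain rfl : n = k := hn
    obtain ⟨e⟩ := nonempty_cohomology_zero_equiv res ε (X := Y)
    have hmem : ∀ φ : Dual.semiInv ε Y, φ.1.comp (π.restrictScalars K) ∈ Dual.semiInv ε (P n) :=
      fun φ a x => by
        change φ.1 (π (a • x)) = ε a * φ.1 (π x)
        rw [map_smul, φ.2]
    let g : Dual.semiInv ε Y →ₗ[K] Dual.semiInv ε (P n) :=
      { toFun := fun φ => ⟨_, hmem φ⟩
        map_add' := fun _ _ => rfl
        map_smul' := fun _ _ => rfl }
    refine ⟨e ≪≫ₗ LinearEquiv.ofBijective g ⟨fun φ ψ h => ?_, fun ψ => ?_⟩⟩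
    · ext y
      obtain ⟨x, rfl⟩ := hπ y
      exact congrArg (fun f : Dual.semiInv ε (P n) => f.1 x) h
    · obtain ⟨φ, hφ⟩ : ∃ φ : Y →ₗ[K] K, ∀ x, φ (π x) = ψ.1 x := by
        obtain ⟨s, hs⟩ := LinearMap.exists_rightInverse_of_surjective (π.restrictScalars K)
          (LinearMap.range_eq_top.2 hπ)
        refine ⟨ψ.1.comp s, fun x => ?_⟩
        have h1 : s (π x) - x ∈ LinearMap.ker π := by
          rw [LinearMap.mem_ker, map_sub, sub_eq_zero]
          exact LinearMap.congr_fun hs (π x)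
        rw [hker] at h1
        obtain ⟨y, hy⟩ := h1
        have h2 := hsemi n ψ.1 ψ.2 y
        rw [hy, map_sub] at h2
        exact sub_eq_zero.1 h2
      refine ⟨⟨φ, fun a y => ?_⟩, Subtype.ext (LinearMap.ext hφ)⟩
      obtain ⟨x, rfl⟩ := hπ y
      rw [← map_smul, hφ, hφ, ψ.2]
  | succ t ih =>
    intro k n hn Y _ _ _ _ π hπ hker
    obtain ⟨e₁⟩ := ih (k + 1) n (by omega) (d k).rangeRestrict (d k).surjective_rangeRestrict
      (by rw [LinearMap.ker_rangeRestrict, hd])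
    obtain ⟨e₂⟩ := nonempty_cohomology_equiv_succ (k := K) res (Dual.map ε π)
      (Dual.map ε (LinearMap.range (d k)).subtype)
      (fun f g h => by
        ext y
        obtain ⟨x, rfl⟩ := hπ y
        exact congrArg (fun f : Dual ε (P k) => f x) h)
      (fun f => by
        obtain ⟨g, hg⟩ := LinearMap.exists_extend
          (p := (LinearMap.range (d k)).restrictScalars K) (f : LinearMap.range (d k) →ₗ[K] K)
        exact ⟨g, hg⟩)
      (by
        ext f
        constructor
        · rintro ⟨g, rfl⟩
          rw [LinearMap.mem_ker]
          ext ⟨y, hy⟩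
          change g (π y) = 0
          have : π y = 0 := by rw [← LinearMap.mem_ker, hker]; exact hy
          rw [this, map_zero]
        · intro hf
          obtain ⟨s, hs⟩ := LinearMap.exists_rightInverse_of_surjective (π.restrictScalars K)
            (LinearMap.range_eq_top.2 hπ)
          refine ⟨LinearMap.comp (f : P k →ₗ[K] K) s, ?_⟩
          ext x
          change f (s (π x)) = f x
          have h1 : s (π x) - x ∈ LinearMap.ker π := by
            rw [LinearMap.mem_ker, map_sub, sub_eq_zero]
            exact LinearMap.congr_fun hs (π x)
          rw [hker] at h1
          have h2 : f (s (π x) - x) = 0 :=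
            congrArg (fun g : Dual ε (LinearMap.range (d k)) => g ⟨_, h1⟩) hf
          rw [map_sub] at h2
          exact sub_eq_zero.1 h2)
      (cocycles_dual_le_coboundaries res ε (c k) (u k) (hcu k))
      (fun f hf => by
        obtain ⟨φ, rfl⟩ := exists_semiInvCocycle_eq res ε f hf
        ext q ⟨_, y, rfl⟩
        change ε (res.ε q) * φ.1 (d k y) = 0
        rw [hsemi k φ.1 φ.2, mul_zero]) t
    exact ⟨e₂.symm ≪≫ₗ e₁⟩

end DualBimodule

section Filtration

variable {k : Type u} [Field k] {Γ : Type v} [Ring Γ] [Algebra k Γ]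

/-- Additivity of `rank Hom_Γ(Q, -)` for projective `Q`. -/
theorem rank_hom_eq_add {Q : Type w} [AddCommGroup Q] [Module Γ Q] [Module.Projective Γ Q]
    {N₁ N N₂ : Type w} [AddCommGroup N₁] [Module Γ N₁] [Module k N₁] [IsScalarTower k Γ N₁]
    [AddCommGroup N] [Module Γ N] [Module k N] [IsScalarTower k Γ N]
    [AddCommGroup N₂] [Module Γ N₂] [Module k N₂] [IsScalarTower k Γ N₂]
    (i : N₁ →ₗ[Γ] N) (p : N →ₗ[Γ] N₂) (hi : Function.Injective i) (hp : Function.Surjective p)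
    (hip : LinearMap.range i = LinearMap.ker p) :
    Module.rank k (Q →ₗ[Γ] N) = Module.rank k (Q →ₗ[Γ] N₂) + Module.rank k (Q →ₗ[Γ] N₁) := by
  let I : (Q →ₗ[Γ] N₁) →ₗ[k] (Q →ₗ[Γ] N) :=
    { toFun := fun f => i.comp f
      map_add' := fun f g => by ext; simp
      map_smul' := fun c f => by ext x; exact LinearMap.map_smul_of_tower i c (f x) }
  let π : (Q →ₗ[Γ] N) →ₗ[k] (Q →ₗ[Γ] N₂) :=
    { toFun := fun f => p.comp f
      map_add' := fun f g => by ext; simp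
      map_smul' := fun c f => by ext x; exact LinearMap.map_smul_of_tower p c (f x) }
  have hI : Function.Injective I := fun f g h => by
    ext x
    exact hi (LinearMap.congr_fun h x)
  have hπ : Function.Surjective π := fun f => Module.projective_lifting_property p f hp
  have hker : LinearMap.range I = LinearMap.ker π := by
    ext f
    constructor
    · rintro ⟨g, rfl⟩
      ext x
      change p (i (g x)) = 0
      rw [← LinearMap.mem_ker, ← hip]
      exact LinearMap.mem_range_self _ _
    · intro hf
      have hmem : ∀ x, f x ∈ LinearMap.range i := fun x => by
        rw [hip]
        exact LinearMap.congr_fun hf x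
      refine ⟨(LinearEquiv.ofInjective i hi).symm.toLinearMap.comp (f.codRestrict _ hmem), ?_⟩
      ext x
      exact congrArg Subtype.val ((LinearEquiv.ofInjective i hi).apply_symm_apply ⟨f x, hmem x⟩)
  rw [LinearMap.rank_eq_of_surjective hπ, ← hker, (LinearEquiv.ofInjective I hI).rank_eq]

end Filtration

section Simple

variable {K : Type u} [Field K] {A : Type u} [Ring A] [Algebra K A]

/-- The one-dimensional module on which `A` acts through a character. -/
def Chr (_η : A →ₐ[K] K) : Type u := K

variable (η : A →ₐ[K] K)

noncomputable instance : AddCommGroup (Chr η) := inferInstanceAs (AddCommGroup K)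
noncomputable instance : Module K (Chr η) := inferInstanceAs (Module K K)
noncomputable instance : Module A (Chr η) := Module.compHom K η.toRingHom

theorem Chr.smul_def (a : A) (x : Chr η) : a • x = (η a • x : Chr η) := rfl

instance : IsScalarTower K A (Chr η) where
  smul_assoc c a x := by
    rw [Chr.smul_def, Chr.smul_def, map_smul, smul_assoc]

variable (ε : A →ₐ[K] K)

theorem jacobson_smul_dual_chr (r : A ⊗[K] Aᵐᵒᵖ) (hr : r ∈ (⊥ : Ideal (A ⊗[K] Aᵐᵒᵖ)).jacobson)
    (f : Dual ε (Chr η)) : r • f = 0 := by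
  let η' : Aᵐᵒᵖ →ₐ[K] K := AlgHom.ofLinearMap
    (η.toLinearMap.comp (MulOpposite.opLinearEquiv K).symm.toLinearMap) (map_one η)
    (fun a b => (map_mul η _ _).trans (mul_comm _ _))
  let χ : A ⊗[K] Aᵐᵒᵖ →ₐ[K] K := Algebra.TensorProduct.lift ε η' fun a b => mul_comm _ _
  have h : ∀ l : A ⊗[K] Aᵐᵒᵖ, l • f = χ l • f := by
    intro l
    induction l using TensorProduct.induction_on with
    | zero => rw [map_zero, zero_smul K]; exact zero_smul (A ⊗[K] Aᵐᵒᵖ) f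
    | tmul a b =>
      ext x
      rw [Dual.tmul_smul_apply, Chr.smul_def, map_smul,
        show χ (a ⊗ₜ[K] b) = _ from Algebra.TensorProduct.lift_tmul _ _ _ _ _, Dual.smul_apply,
        mul_assoc]
      rfl
    | add x y hx hy => rw [add_smul, hx, hy, map_add, add_smul]
  have hmax : (RingHom.ker χ.toRingHom).IsMaximal :=
    RingHom.ker_isMaximal_of_surjective _ fun c => ⟨algebraMap K _ c, χ.commutes c⟩
  have h0 : χ r = 0 := by
    have := (Ideal.mem_sInf.1 hr) ⟨bot_le, hmax⟩
    exact this
  rw [h, h0, zero_smul]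

attribute [local instance] TensorProduct.Algebra.module

/-- The dimension of `Hom(Q, A)` for a projective bimodule `Q`, computed from the multiplicities
of the simple factors of a triangular basis of `A`. -/
theorem rank_hom_eq_sum {I : Type*} (ε : I → A →ₐ[K] K) {n : ℕ} (b : Module.Basis (Fin n) K A)
    (src tgt : Fin n → I)
    (hl : ∀ (a x : A) p, (∀ q < p, b.repr x q = 0) → b.repr (a * x) p = ε (tgt p) a * b.repr x p)
    (hr : ∀ (a x : A) p, (∀ q < p, b.repr x q = 0) → b.repr (x * a) p = ε (src p) a * b.repr x p)
    [IsScalarTower K (A ⊗[K] Aᵐᵒᵖ) A]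
    {Q : Type u} [AddCommGroup Q] [Module (A ⊗[K] Aᵐᵒᵖ) Q] [Module.Projective (A ⊗[K] Aᵐᵒᵖ) Q] :
    Module.rank K (Q →ₗ[A ⊗[K] Aᵐᵒᵖ] A) =
      ∑ p, Module.rank K (Q →ₗ[A ⊗[K] Aᵐᵒᵖ] Dual (ε (tgt p)) (Chr (ε (src p)))) := by
  let F : ℕ → Submodule (A ⊗[K] Aᵐᵒᵖ) A := fun m =>
    { carrier := {x | ∀ q : Fin n, q.val < m → b.repr x q = 0}
      add_mem' := fun {x y} hx hy q hq => by
        rw [map_add, Finsupp.add_apply, hx q hq, hy q hq, add_zero]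
      zero_mem' := fun q hq => by simp
      smul_mem' := fun l x hx => by
        induction l using TensorProduct.induction_on with
        | zero =>
          intro q hq
          rw [show b.repr ((0 : A ⊗[K] Aᵐᵒᵖ) • x) = b.repr 0 from
            congrArg b.repr (zero_smul (A ⊗[K] Aᵐᵒᵖ) x), map_zero]
          rfl
        | tmul a c =>
          intro q hq
          have h1 : ∀ q : Fin n, q.val < m → b.repr (x * c.unop) q = 0 := fun q hq => by
            rw [hr _ _ _ fun q' hq' => hx q' (lt_trans hq' hq), hx q hq, mul_zero]
          rw [env_tmul_smul, hl _ _ _ fun q' hq' => h1 q' (lt_trans hq' hq), h1 q hq, mul_zero]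
        | add l m hl hm =>
          intro q hq
          rw [add_smul, map_add, Finsupp.add_apply, hl q hq, hm q hq, add_zero] }
  have hF : ∀ m x, x ∈ F m ↔ ∀ q : Fin n, q.val < m → b.repr x q = 0 := fun _ _ => Iff.rfl
  let r : Fin n → Cardinal := fun p =>
    Module.rank K (Q →ₗ[A ⊗[K] Aᵐᵒᵖ] Dual (ε (tgt p)) (Chr (ε (src p))))
  have step : ∀ p : Fin n, Module.rank K (Q →ₗ[A ⊗[K] Aᵐᵒᵖ] F p) =
      r p + Module.rank K (Q →ₗ[A ⊗[K] Aᵐᵒᵖ] F (p + 1)) := by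
    intro p
    have hle : F (p + 1) ≤ F p := fun x hx q hq => hx q (hq.trans (Nat.lt_succ_self _))
    let θ : F p →ₗ[A ⊗[K] Aᵐᵒᵖ] Dual (ε (tgt p)) (Chr (ε (src p))) :=
      Dual.mkLinear (ε (tgt p)) (X := Chr (ε (src p))) (Q := F p)
        (fun x => (b.repr x.1 p • (LinearMap.id : K →ₗ[K] K) : K →ₗ[K] K))
        (fun x y => ?_) (fun a c x => ?_)
    · refine rank_hom_eq_add (N₁ := F (p + 1)) (N := F p) (Submodule.inclusion hle) θ
        (Submodule.inclusion_injective hle) (fun f => ?_) ?_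
      · let f' : K →ₗ[K] K := f
        refine ⟨⟨f' 1 • b p, fun q hq => ?_⟩, ?_⟩
        · rw [map_smul, b.repr_self, Finsupp.smul_apply, Finsupp.single_eq_of_ne, smul_zero]
          exact ne_of_lt hq
        · ext (y : K)
          change b.repr (f' 1 • b p) p * y = f' y
          rw [map_smul, b.repr_self, Finsupp.smul_apply, Finsupp.single_eq_same, smul_eq_mul,
            mul_one, mul_comm, ← smul_eq_mul, ← map_smul, smul_eq_mul, mul_one]
      · rw [Submodule.range_inclusion]
        ext x
        rw [LinearMap.mem_ker, Submodule.mem_comap]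
        constructor
        · intro hx
          ext (y : K)
          change b.repr x.1 p * y = 0
          have h1 : b.repr x.1 p = 0 := hx p (Nat.lt_succ_self _)
          rw [h1, zero_mul]
        · intro hx
          have h1 : b.repr x.1 p * (1 : K) = 0 :=
            congrArg (fun f : Dual (ε (tgt p)) (Chr (ε (src p))) => f (1 : K)) hx
          refine (hF _ _).2 fun q hq => ?_
          rcases Nat.lt_succ_iff_lt_or_eq.1 hq with h | h
          · exact x.2 q h
          · rw [Fin.ext h]
            rwa [mul_one] at h1
    · change ((b.repr (x.1 + y.1) p) • (LinearMap.id : K →ₗ[K] K) : K →ₗ[K] K) = _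
      rw [map_add, Finsupp.add_apply, add_smul]
      rfl
    · intro (y : K)
      change b.repr (a * (x.1 * c)) p * y = ε (tgt p) a * (b.repr x.1 p * (ε (src p) c * y))
      rw [hl, hr _ _ _ x.2]
      · ring
      · intro q hq
        rw [hr _ _ _ fun q' hq' => x.2 q' (lt_trans hq' hq), x.2 q hq, mul_zero]
  have key : ∀ m ≤ n, Module.rank K (Q →ₗ[A ⊗[K] Aᵐᵒᵖ] F 0) =
      ∑ i ∈ Finset.range m, (if h : i < n then r ⟨i, h⟩ else 0) +
        Module.rank K (Q →ₗ[A ⊗[K] Aᵐᵒᵖ] F m) := by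
    intro m
    induction m with
    | zero => intro _; simp
    | succ m ih =>
      intro hm
      rw [ih (by omega), Finset.sum_range_succ, dif_pos (show m < n by omega), add_assoc,
        ← step ⟨m, hm⟩]
  have htop : F 0 = ⊤ := by
    rw [eq_top_iff]
    exact fun x _ q hq => absurd hq (Nat.not_lt_zero _)
  have hbot : ∀ x : F n, x = 0 := fun x => by
    refine Subtype.ext (b.repr.injective ?_)
    ext q
    rw [x.2 q q.2]
    simp
  have hsub : Subsingleton (Q →ₗ[A ⊗[K] Aᵐᵒᵖ] F n) :=
    ⟨fun f g => LinearMap.ext fun x => (hbot _).trans (hbot _).symm⟩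
  have h0 : Module.rank K (Q →ₗ[A ⊗[K] Aᵐᵒᵖ] A) = Module.rank K (Q →ₗ[A ⊗[K] Aᵐᵒᵖ] F 0) := by
    let e : (Q →ₗ[A ⊗[K] Aᵐᵒᵖ] F 0) →ₗ[K] (Q →ₗ[A ⊗[K] Aᵐᵒᵖ] A) :=
      { toFun := fun f => (F 0).subtype.comp f
        map_add' := fun _ _ => rfl
        map_smul' := fun _ _ => rfl }
    refine (LinearEquiv.rank_eq (LinearEquiv.ofBijective e ⟨fun f g h => ?_, fun f => ?_⟩)).symm
    · ext x
      exact LinearMap.congr_fun h x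
    · exact ⟨f.codRestrict _ fun x => by rw [htop]; trivial, rfl⟩
  rw [h0, key n le_rfl, rank_subsingleton', add_zero, Finset.sum_fin_eq_sum_range]

end Simple

/-! ### The nonzero paths of `𝒬₁` -/

/-- The nonzero paths of `𝒬₁` as triples (source, target, length), ordered by length. -/
def pathList : List (ℕ × ℕ × ℕ) :=
  [(0, 0, 0), (1, 1, 0), (2, 2, 0), (3, 3, 0), (4, 4, 0), (5, 5, 0),
   (0, 1, 1), (1, 2, 1), (2, 5, 1), (0, 3, 1), (3, 4, 1), (4, 5, 1), (5, 0, 1),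
   (0, 2, 2), (0, 4, 2), (1, 5, 2), (2, 0, 2), (3, 5, 2), (4, 0, 2), (5, 1, 2), (5, 3, 2),
   (0, 5, 3), (1, 0, 3), (2, 1, 3), (3, 0, 3), (4, 3, 3), (5, 2, 3), (5, 4, 3),
   (0, 0, 4), (1, 1, 4), (2, 2, 4), (3, 3, 4), (4, 4, 4), (5, 5, 4)]

/-- Indices of the nonzero paths. -/
abbrev Pth : Type := Fin 34

/-- Source, target and length of a path. -/
def trip (p : Pth) : ℕ × ℕ × ℕ := pathList.getD p.val (0, 0, 0)

/-- The source of a path. -/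
def src (p : Pth) : Fin 6 := Fin.ofNat 6 (trip p).1
/-- The target of a path. -/
def tgt (p : Pth) : Fin 6 := Fin.ofNat 6 (trip p).2.1
/-- The length of a path. -/
def len (p : Pth) : ℕ := (trip p).2.2

/-- The table of the nonzero paths: the digit at place `9 (6 i + j) + l` in base `64` is `0` or
one more than the index of the path of length `l` from `i` to `j`. -/
def pathTable : ℕ :=
  50453421407986860071412265691819496417077209835127954213957963409587660370296673723088811688831123058199492587630530213747296650203739406380324652427023187013237217624441733384147677980641610484965847740892827924715545837692206602071386574604587690591359861765044064782672353850272644665501917602366372908083949466783558508371329645778043715142536482483107185855520583208064888931034255411516838801780470382006860436035994230535141446198507326053322874685800321020523050419006873175548377978900444294650455507914117904391171249931824600011962453894304545322863144454834301698049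

/-- The path with given source, target and length, if it is nonzero. -/
def findPath (x : ℕ × ℕ × ℕ) : Option Pth :=
  match pathTable / 64 ^ (9 * (6 * x.1 + x.2.1) + x.2.2) % 64 with
  | 0 => none
  | i + 1 => some (Fin.ofNat 34 i)

/-- The product `p q` (first `q`, then `p`). -/
def pathMul (p q : Pth) : Option Pth :=
  if (trip q).2.1 = (trip p).1 then
    findPath ((trip q).1, (trip p).2.1, (trip p).2.2 + (trip q).2.2)
  else none

/-- Words for the nonzero paths, in the letters `0, …, 5` (trivial paths), `6, 7, 8` (arrows `α`),
`9, 10, 11` (arrows `β`) and `12` (the arrow `γ`). -/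
def wordList : List (List ℕ) :=
  [[0], [1], [2], [3], [4], [5], [6], [7], [8], [9], [10], [11], [12],
   [7, 6], [10, 9], [8, 7], [12, 8], [11, 10], [12, 11], [6, 12], [9, 12],
   [8, 7, 6], [12, 8, 7], [6, 12, 8], [12, 11, 10], [9, 12, 11], [7, 6, 12], [10, 9, 12],
   [12, 8, 7, 6], [6, 12, 8, 7], [7, 6, 12, 8], [9, 12, 11, 10], [10, 9, 12, 11], [8, 7, 6, 12]]

/-- The word of a path. -/
def word (p : Pth) : List ℕ := wordList.getD p.val []

/-- One reduction step at the beginning of a word in the arrows. -/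
def reduceWord (w : List ℕ) : Option (List ℕ) :=
  if 5 ≤ w.length then none
  else if w.take 3 = [6, 12, 11] ∨ w.take 3 = [9, 12, 8] then none
  else if w.take 3 = [11, 10, 9] then some (8 :: 7 :: 6 :: w.drop 3)
  else some w

/-- The trivial path at a vertex. -/
def triv (i : Fin 6) : Pth := Fin.castLE (by decide) i

theorem pathMul_gt_or_left (p q r : Pth) (h : pathMul p q = some r) :
    q < r ∨ (r = q ∧ p = triv (tgt q)) := by
  have key : ∀ p q : Pth, (pathMul p q).all
      (fun r => decide (q < r ∨ (r = q ∧ p = triv (tgt q)))) = true := by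
    decide +kernel
  simpa [h] using key p q

theorem pathMul_gt_or_right (p q r : Pth) (h : pathMul q p = some r) :
    q < r ∨ (r = q ∧ p = triv (src q)) := by
  have key : ∀ p q : Pth, (pathMul q p).all
      (fun r => decide (q < r ∨ (r = q ∧ p = triv (src q)))) = true := by
    decide +kernel
  simpa [h] using key p q

theorem triv_pathMul : ∀ (i : Fin 6) (p : Pth),
    pathMul (triv i) p = if i = tgt p then some p else none := by
  decide +kernel

theorem pathMul_triv : ∀ (i : Fin 6) (p : Pth),
    pathMul p (triv i) = if i = src p then some p else none := by
  decide +kernel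

theorem pathMul_assoc : ∀ p : Pth, p.val < 13 → ∀ q r : Pth,
    (pathMul p q).bind (pathMul · r) = (pathMul q r).bind (pathMul p ·) := by
  decide +kernel

theorem len_pathMul (p q r : Pth) (h : pathMul p q = some r) : len r = len p + len q := by
  have key : ∀ p q : Pth, (pathMul p q).all
      (fun r => decide (len r = len p + len q)) = true := by
    decide +kernel
  simpa [h] using key p q

theorem len_le : ∀ p : Pth, len p ≤ 4 := by
  decide +kernel

theorem reduceWord_word : ∀ p : Pth, p.val < 13 → 6 ≤ p.val → ∀ q : Pth, 6 ≤ q.val → src p = tgt q →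
    reduceWord (p.val :: word q) = (pathMul p q).map word := by
  decide +kernel

theorem pathMul_eq_none : ∀ p q : Pth, src p ≠ tgt q → pathMul p q = none := by
  decide +kernel

theorem word_cons (q : Pth) (h : 13 ≤ q.val) : ∃ p q' : Pth, p.val < 13 ∧ 6 ≤ p.val ∧ q' < q ∧
    word q = p.val :: word q' ∧ pathMul p q' = some q ∧ tgt p = tgt q := by
  have key : ∀ q : Pth, 13 ≤ q.val → ∃ p : Pth, p.val < 13 ∧ 6 ≤ p.val ∧ tgt p = tgt q ∧
      ∃ q' : Pth, q' < q ∧ word q = p.val :: word q' ∧ pathMul p q' = some q := by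
    decide +kernel
  obtain ⟨p, h1, h2, h3, q', h4, h5, h6⟩ := key q h
  exact ⟨p, q', h1, h2, h4, h5, h6, h3⟩

theorem word_of_lt : ∀ q : Pth, q.val < 13 → word q = [q.val] := by
  decide +kernel

theorem mem_word : ∀ q : Pth, 6 ≤ q.val → ∀ n ∈ word q, 6 ≤ n ∧ n < 13 := by
  decide +kernel

/-! ### A basis of `R_1` -/

section Structure

variable (K : Type u) [Field K]

/-- The letters of `wordList` as generators. -/
def letter (n : ℕ) : Gen 1 :=
  if n < 6 then Gen.e (n : ZMod (6 * 1))
  else if n < 9 then Gen.a ((n - 6 : ℕ) : ZMod (3 * 1))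
  else if n < 12 then Gen.b ((n - 9 : ℕ) : ZMod (3 * 1))
  else Gen.g 0

/-- The path attached to a generator. -/
def genPath : Gen 1 → Pth
  | Gen.e i => Fin.ofNat 34 i.val
  | Gen.a i => Fin.ofNat 34 (i.val + 6)
  | Gen.b i => Fin.ofNat 34 (i.val + 9)
  | Gen.g _ => 12

theorem genPath_lt (x : Gen 1) : (genPath x).val < 13 := by
  rcases x with i | i | i | i
  · revert i; decide
  · revert i; decide
  · revert i; decide
  · exact (by decide : (12 : Pth).val < 13)

theorem letter_genPath (x : Gen 1) : letter (genPath x).val = x := by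
  rcases x with i | i | i | i
  · have h : ∀ i : ZMod (6 * 1), (genPath (Gen.e i)).val < 6 ∧
      (((genPath (Gen.e i)).val : ℕ) : ZMod (6 * 1)) = i := by decide
    rw [letter, if_pos (h i).1, (h i).2]
  · have h : ∀ i : ZMod (3 * 1), ¬ (genPath (Gen.a i)).val < 6 ∧ (genPath (Gen.a i)).val < 9 ∧
      (((genPath (Gen.a i)).val - 6 : ℕ) : ZMod (3 * 1)) = i := by decide
    rw [letter, if_neg (h i).1, if_pos (h i).2.1, (h i).2.2]
  · have h : ∀ i : ZMod (3 * 1), ¬ (genPath (Gen.b i)).val < 6 ∧ ¬ (genPath (Gen.b i)).val < 9 ∧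
      (genPath (Gen.b i)).val < 12 ∧
      (((genPath (Gen.b i)).val - 9 : ℕ) : ZMod (3 * 1)) = i := by decide
    rw [letter, if_neg (h i).1, if_neg (h i).2.1, if_pos (h i).2.2.1, (h i).2.2.2]
  · have h : ∀ i : ZMod 1, (0 : ZMod 1) = i := by decide
    exact congrArg Gen.g (h i)

/-- The letters as elements of the free algebra. -/
noncomputable def freeLetter (n : ℕ) : F K 1 := FreeAlgebra.ι K (letter n)

/-- The quotient map from the free algebra. -/
noncomputable abbrev toAlg : F K 1 →ₐ[K] Alg K 1 := RingQuot.mkAlgHom K (Rel K 1)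

/-- The element of `R_1` given by a word. -/
noncomputable def wordElem (w : List ℕ) : Alg K 1 := (w.map fun n => toAlg K (freeLetter K n)).prod

/-- The element of `R_1` given by a path. -/
noncomputable def pathElem (p : Pth) : Alg K 1 := wordElem K (word p)

/-- The element of `R_1` given by a path, or zero. -/
noncomputable def optElem (x : Option Pth) : Alg K 1 := x.elim 0 (pathElem K)

theorem toAlg_rel {x y : F K 1} (h : Rel K 1 x y) : toAlg K x = toAlg K y :=
  RingQuot.mkAlgHom_rel K h

theorem wordElem_cons (n : ℕ) (w : List ℕ) :
    wordElem K (n :: w) = toAlg K (freeLetter K n) * wordElem K w := List.prod_cons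

theorem freeLetter_mem_arrows (n : ℕ) (h : 6 ≤ n) : freeLetter K n ∈ arrows K 1 := by
  unfold freeLetter letter arrows
  rw [if_neg (by omega)]
  split_ifs
  · exact Or.inl (Or.inl ⟨_, rfl⟩)
  · exact Or.inl (Or.inr ⟨_, rfl⟩)
  · exact Or.inr ⟨_, rfl⟩

theorem wordElem_eq_zero_of_length : ∀ w : List ℕ, 5 ≤ w.length → (∀ n ∈ w, 6 ≤ n) →
    wordElem K w = 0
  | a :: b :: c :: d :: e :: w, _, h => by
    have := toAlg_rel K (Rel.len5 _ _ _ _ _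
      (freeLetter_mem_arrows K a (h a (by simp))) (freeLetter_mem_arrows K b (h b (by simp)))
      (freeLetter_mem_arrows K c (h c (by simp))) (freeLetter_mem_arrows K d (h d (by simp)))
      (freeLetter_mem_arrows K e (h e (by simp))))
    simp only [map_mul, map_zero] at this
    simp only [wordElem_cons, ← mul_assoc, this, zero_mul]

theorem wordElem_reduceWord (w : List ℕ) (h : ∀ n ∈ w, 6 ≤ n) :
    wordElem K w = (reduceWord w).elim 0 (wordElem K) := by
  unfold reduceWord
  split_ifs with h1 h2 h3
  · exact wordElem_eq_zero_of_length K w h1 h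
  · rcases h2 with h2 | h2
    · rw [← List.take_append_drop 3 w, h2]
      have := toAlg_rel K (Rel.zero_agb (0 : Fin 1))
      simp only [map_mul, map_zero] at this
      simp only [List.cons_append, List.nil_append, wordElem_cons, ← mul_assoc]
      refine (congrArg (· * _) this).trans (zero_mul _)
    · rw [← List.take_append_drop 3 w, h2]
      have := toAlg_rel K (Rel.zero_bga (0 : Fin 1))
      simp only [map_mul, map_zero] at this
      simp only [List.cons_append, List.nil_append, wordElem_cons, ← mul_assoc]
      refine (congrArg (· * _) this).trans (zero_mul _)
  · conv_lhs => rw [← List.take_append_drop 3 w, h3]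
    have := toAlg_rel K (Rel.comm (0 : Fin 1))
    simp only [map_mul] at this
    simp only [List.cons_append, List.nil_append, Option.elim_some, wordElem_cons, ← mul_assoc]
    exact (congrArg (· * _) this).symm
  · rfl


theorem pathElem_of_lt (p : Pth) (h : p.val < 13) :
    pathElem K p = toAlg K (freeLetter K p.val) := by
  rw [pathElem, word_of_lt p h, wordElem_cons]
  exact mul_one _

theorem pathElem_triv (i : Fin 6) :
    pathElem K (triv i) = toAlg K (E K 1 ((i.val : ℕ) : ZMod (6 * 1))) := by
  rw [pathElem_of_lt K _ (lt_trans i.isLt (by decide)), freeLetter, letter]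
  exact congrArg (fun x => toAlg K (FreeAlgebra.ι K x)) (if_pos i.isLt)

theorem pathElem_triv_mul_triv (i j : Fin 6) :
    pathElem K (triv i) * pathElem K (triv j) = if i = j then pathElem K (triv i) else 0 := by
  have hij : ((i.val : ZMod (6 * 1)) = (j.val : ZMod (6 * 1))) ↔ i = j := by
    revert i j; decide
  rw [pathElem_triv, pathElem_triv, ← map_mul, toAlg_rel K (Rel.idem _ _)]
  simp only [hij]
  split_ifs
  · rfl
  · exact map_zero _

theorem eq_triv : ∀ p : Pth, p.val < 6 → p = triv (src p) ∧ p = triv (tgt p) := by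
  decide

theorem triv_tgt_mul_arrow (p : Pth) (h6 : 6 ≤ p.val) (h : p.val < 13) :
    pathElem K (triv (tgt p)) * pathElem K p = pathElem K p := by
  rw [pathElem_triv, pathElem_of_lt K p h, ← map_mul]
  obtain ⟨n, hn⟩ := p
  simp only at h6 h
  interval_cases n
  · exact toAlg_rel K (Rel.a_tgt (0 : Fin 3))
  · exact toAlg_rel K (Rel.a_tgt (1 : Fin 3))
  · exact toAlg_rel K (Rel.a_tgt (2 : Fin 3))
  · exact toAlg_rel K (Rel.b_tgt (0 : Fin 3))
  · exact toAlg_rel K (Rel.b_tgt (1 : Fin 3))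
  · exact toAlg_rel K (Rel.b_tgt (2 : Fin 3))
  · have h0 : ((tgt 12).val : ZMod (6 * 1)) = gTgt 1 0 := by decide
    change toAlg K (E K 1 ((tgt 12).val : ZMod (6 * 1)) * G K 1 0) = toAlg K (G K 1 0)
    rw [h0]
    exact toAlg_rel K (Rel.g_tgt 0)

theorem arrow_mul_triv_src (p : Pth) (h6 : 6 ≤ p.val) (h : p.val < 13) :
    pathElem K p * pathElem K (triv (src p)) = pathElem K p := by
  rw [pathElem_triv, pathElem_of_lt K p h, ← map_mul]
  obtain ⟨n, hn⟩ := p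
  simp only at h6 h
  interval_cases n
  · exact toAlg_rel K (Rel.a_src (0 : Fin 3))
  · exact toAlg_rel K (Rel.a_src (1 : Fin 3))
  · exact toAlg_rel K (Rel.a_src (2 : Fin 3))
  · exact toAlg_rel K (Rel.b_src (0 : Fin 3))
  · exact toAlg_rel K (Rel.b_src (1 : Fin 3))
  · exact toAlg_rel K (Rel.b_src (2 : Fin 3))
  · exact toAlg_rel K (Rel.g_src (0 : ZMod 1))

theorem triv_tgt_mul (q : Pth) : pathElem K (triv (tgt q)) * pathElem K q = pathElem K q := by
  rcases lt_or_ge q.val 6 with h | h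
  · conv_lhs => rw [(eq_triv q h).2, pathElem_triv_mul_triv]
    have : tgt (triv (tgt q)) = tgt q := by rw [← (eq_triv q h).2]
    rw [if_pos this, this, ← (eq_triv q h).2]
  rcases lt_or_ge q.val 13 with h' | h'
  · exact triv_tgt_mul_arrow K q h h'
  · obtain ⟨p, q', hp, hp6, -, hw, -, ht⟩ := word_cons q h'
    have : pathElem K q = pathElem K p * pathElem K q' := by
      rw [pathElem, hw, wordElem_cons, pathElem_of_lt K p hp]; rfl
    rw [this, ← mul_assoc, ← ht, triv_tgt_mul_arrow K p hp6 hp]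

theorem letter_mul (p : Pth) (hp : p.val < 13) (q : Pth) :
    pathElem K p * pathElem K q = optElem K (pathMul p q) := by
  have hsrc : pathElem K p * pathElem K (triv (src p)) = pathElem K p := by
    rcases lt_or_ge p.val 6 with h | h
    · conv_lhs => rw [(eq_triv p h).1, pathElem_triv_mul_triv]
      have : src (triv (src p)) = src p := by rw [← (eq_triv p h).1]
      rw [this, if_pos rfl, ← (eq_triv p h).1]
    · exact arrow_mul_triv_src K p h hp
  by_cases hpq : src p = tgt q
  · rcases lt_or_ge p.val 6 with h | h
    · have hq : p = triv (tgt q) := by rw [← hpq]; exact (eq_triv p h).1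
      rw [hq, triv_tgt_mul, triv_pathMul, if_pos rfl]; rfl
    rcases lt_or_ge q.val 6 with h' | h'
    · have hq : q = triv (src p) := by rw [hpq]; exact (eq_triv q h').2
      rw [hq, hsrc, pathMul_triv, if_pos rfl]; rfl
    · have hw : pathElem K p * pathElem K q = wordElem K (p.val :: word q) := by
        rw [wordElem_cons, pathElem_of_lt K p hp]; rfl
      rw [hw, wordElem_reduceWord, reduceWord_word p hp h q h' hpq]
      · cases pathMul p q <;> rfl
      · intro n hn
        rcases List.mem_cons.1 hn with rfl | hn
        · exact h
        · exact (mem_word q h' n hn).1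
  · rw [pathMul_eq_none p q hpq, ← hsrc, ← triv_tgt_mul K q, mul_assoc,
      ← mul_assoc (pathElem K (triv (src p))), pathElem_triv_mul_triv, if_neg hpq, zero_mul,
      mul_zero]
    rfl

theorem pathElem_mul (p q : Pth) : pathElem K p * pathElem K q = optElem K (pathMul p q) := by
  induction p using WellFoundedLT.induction generalizing q with
  | _ p ih =>
  rcases lt_or_ge p.val 13 with h | h
  · exact letter_mul K p h q
  · obtain ⟨a, p', ha, -, hlt, -, hm, -⟩ := word_cons p h
    have hp : pathElem K p = pathElem K a * pathElem K p' := by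
      rw [letter_mul K a ha, hm]; rfl
    have hassoc := pathMul_assoc a ha p' q
    rw [hm, Option.bind_some] at hassoc
    rw [hp, mul_assoc, ih p' hlt, hassoc]
    cases pathMul p' q with
    | none => exact mul_zero _
    | some r => exact letter_mul K a ha r

theorem sum_triv : ∑ i : Fin 6, pathElem K (triv i) = 1 := by
  have h := toAlg_rel K (Rel.sum_one)
  rw [map_one, map_sum] at h
  rw [← h, Finset.sum_range]
  exact Finset.sum_congr rfl fun i _ => pathElem_triv K i

theorem span_pathElem : Submodule.span K (Set.range (pathElem K)) = ⊤ := by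
  set S := Submodule.span K (Set.range (pathElem K)) with hS
  have key : ∀ (x : F K 1), ∀ y ∈ S, toAlg K x * y ∈ S := by
    intro x
    induction x using FreeAlgebra.induction with
    | grade0 r =>
      intro y hy
      rw [AlgHom.commutes, ← Algebra.smul_def]
      exact S.smul_mem r hy
    | grade1 x =>
      intro y hy
      have hx : toAlg K (FreeAlgebra.ι K x) = pathElem K (genPath x) := by
        rw [pathElem_of_lt K _ (genPath_lt x), freeLetter, letter_genPath]
      rw [hx]
      refine Submodule.span_induction (p := fun y _ => pathElem K (genPath x) * y ∈ S)
        ?_ ?_ ?_ ?_ hy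
      · rintro _ ⟨q, rfl⟩
        rw [pathElem_mul]
        cases pathMul (genPath x) q with
        | none => exact S.zero_mem
        | some r => exact Submodule.subset_span ⟨r, rfl⟩
      · simp
      · intro a b _ _ ha hb
        rw [mul_add]
        exact S.add_mem ha hb
      · intro r a _ ha
        rw [mul_smul_comm]
        exact S.smul_mem r ha
    | mul a b ha hb =>
      intro y hy
      rw [map_mul, mul_assoc]
      exact ha _ (hb _ hy)
    | add a b ha hb =>
      intro y hy
      rw [map_add, add_mul]
      exact S.add_mem (ha _ hy) (hb _ hy)
  refine eq_top_iff.2 fun z _ => ?_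
  obtain ⟨x, rfl⟩ := RingQuot.mkAlgHom_surjective K (Rel K 1) z
  rw [← mul_one (RingQuot.mkAlgHom K (Rel K 1) x)]
  refine key x 1 ?_
  rw [← sum_triv]
  exact Submodule.sum_mem _ fun i _ => Submodule.subset_span ⟨_, rfl⟩
/-- A basis vector, or zero. -/
noncomputable def optSingle (x : Option Pth) : Pth →₀ K := x.elim 0 fun r => Finsupp.single r 1

/-- Left multiplication by a path on the space spanned by the nonzero paths. -/
noncomputable def leftPath (p : Pth) : Module.End K (Pth →₀ K) :=
  Finsupp.linearCombination K fun q => optSingle K (pathMul p q)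

/-- Left multiplication by a path, or zero. -/
noncomputable def leftOpt (x : Option Pth) : Module.End K (Pth →₀ K) := x.elim 0 (leftPath K)

theorem leftPath_single (p q : Pth) :
    leftPath K p (Finsupp.single q 1) = optSingle K (pathMul p q) := by
  rw [leftPath, Finsupp.linearCombination_single, one_smul]

theorem leftPath_optSingle (p : Pth) (x : Option Pth) :
    leftPath K p (optSingle K x) = optSingle K (x.bind (pathMul p)) := by
  cases x with
  | none => exact map_zero _
  | some q => exact leftPath_single K p q

theorem leftPath_mul (p : Pth) (hp : p.val < 13) (q : Pth) :
    leftPath K p * leftPath K q = leftOpt K (pathMul p q) := by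
  refine Finsupp.lhom_ext' fun r => LinearMap.ext_ring ?_
  change leftPath K p (leftPath K q (Finsupp.single r 1)) =
    leftOpt K (pathMul p q) (Finsupp.single r 1)
  rw [leftPath_single, leftPath_optSingle, ← pathMul_assoc p hp q r]
  cases pathMul p q with
  | none => rfl
  | some t => exact (leftPath_single K t r).symm

theorem leftPath_mul_leftOpt (p : Pth) (hp : p.val < 13) (x : Option Pth) :
    leftPath K p * leftOpt K x = leftOpt K (x.bind (pathMul p)) := by
  cases x with
  | none => exact mul_zero _
  | some q => exact leftPath_mul K p hp q

/-- The left regular representation on generators. -/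
noncomputable def freeRep : F K 1 →ₐ[K] Module.End K (Pth →₀ K) :=
  FreeAlgebra.lift K fun x => leftPath K (genPath x)

theorem freeRep_ι (x : Gen 1) : freeRep K (FreeAlgebra.ι K x) = leftPath K (genPath x) :=
  FreeAlgebra.lift_ι_apply _ _

theorem freeRep_mul (x y : Gen 1) : freeRep K (FreeAlgebra.ι K x * FreeAlgebra.ι K y) =
    leftOpt K (pathMul (genPath x) (genPath y)) := by
  rw [map_mul, freeRep_ι, freeRep_ι, leftPath_mul K _ (genPath_lt x)]

theorem freeRep_mul_mul (x y z : Gen 1) :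
    freeRep K (FreeAlgebra.ι K x * FreeAlgebra.ι K y * FreeAlgebra.ι K z) =
      leftOpt K ((pathMul (genPath y) (genPath z)).bind (pathMul (genPath x))) := by
  rw [mul_assoc, map_mul, freeRep_mul, freeRep_ι, leftPath_mul_leftOpt K _ (genPath_lt x)]

theorem freeRep_arrow (x : F K 1) (hx : x ∈ arrows K 1) :
    ∃ p : Pth, p.val < 13 ∧ len p = 1 ∧ freeRep K x = leftPath K p := by
  rcases hx with (⟨i, rfl⟩ | ⟨i, rfl⟩) | ⟨i, rfl⟩
  · exact ⟨_, genPath_lt (Gen.a i), by revert i; decide, freeRep_ι K _⟩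
  · exact ⟨_, genPath_lt (Gen.b i), by revert i; decide, freeRep_ι K _⟩
  · exact ⟨_, genPath_lt (Gen.g i), by revert i; decide, freeRep_ι K _⟩

theorem freeRep_arrow_mul (x : F K 1) (hx : x ∈ arrows K 1) (f : Module.End K (Pth →₀ K)) (k : ℕ)
    (hf : ∃ y, f = leftOpt K y ∧ ∀ r ∈ y, len r = k) :
    ∃ y, freeRep K x * f = leftOpt K y ∧ ∀ r ∈ y, len r = k + 1 := by
  obtain ⟨p, hp, h1, hx⟩ := freeRep_arrow K x hx
  obtain ⟨y, rfl, hy⟩ := hf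
  refine ⟨y.bind (pathMul p), by rw [hx, leftPath_mul_leftOpt K p hp], fun r hr => ?_⟩
  obtain ⟨q, hq, hr⟩ := Option.bind_eq_some_iff.1 hr
  rw [len_pathMul p q r hr, h1, hy q hq, add_comm]

theorem freeRep_rel {x y : F K 1} (h : Rel K 1 x y) : freeRep K x = freeRep K y := by
  induction h with
  | idem i j =>
    have h : ∀ i j : ZMod (6 * 1), pathMul (genPath (Gen.e i)) (genPath (Gen.e j)) =
        if i = j then some (genPath (Gen.e i)) else none := by decide +kernel
    rw [E, E, freeRep_mul, h]
    split_ifs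
    · exact (freeRep_ι K _).symm
    · exact (map_zero _).symm
  | sum_one =>
    rw [map_sum, map_one, Finset.sum_range]
    refine Finsupp.lhom_ext' fun r => LinearMap.ext_ring ?_
    change (∑ i : Fin 6, _ : Module.End K (Pth →₀ K)) (Finsupp.single r 1) = Finsupp.single r 1
    rw [LinearMap.sum_apply]
    have h : ∀ i : Fin 6, freeRep K (E K 1 (i.val : ZMod (6 * 1))) (Finsupp.single r 1) =
        if i = tgt r then Finsupp.single r 1 else 0 := by
      intro i
      have hi : genPath (Gen.e (i.val : ZMod (6 * 1))) = triv i := by revert i; decide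
      rw [E, freeRep_ι, hi, leftPath_single, triv_pathMul]
      split_ifs <;> rfl
    exact (Finset.sum_congr rfl fun i _ => h i).trans (by simp)
  | a_tgt i =>
    have h : ∀ i : ZMod (3 * 1), pathMul (genPath (Gen.e (aTgt 1 i))) (genPath (Gen.a i)) =
        some (genPath (Gen.a i)) := by decide +kernel
    rw [E, A, freeRep_mul, h, freeRep_ι]; rfl
  | a_src i =>
    have h : ∀ i : ZMod (3 * 1), pathMul (genPath (Gen.a i)) (genPath (Gen.e (aSrc 1 i))) =
        some (genPath (Gen.a i)) := by decide +kernel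
    rw [E, A, freeRep_mul, h, freeRep_ι]; rfl
  | b_tgt i =>
    have h : ∀ i : ZMod (3 * 1), pathMul (genPath (Gen.e (bTgt 1 i))) (genPath (Gen.b i)) =
        some (genPath (Gen.b i)) := by decide +kernel
    rw [E, B, freeRep_mul, h, freeRep_ι]; rfl
  | b_src i =>
    have h : ∀ i : ZMod (3 * 1), pathMul (genPath (Gen.b i)) (genPath (Gen.e (bSrc 1 i))) =
        some (genPath (Gen.b i)) := by decide +kernel
    rw [E, B, freeRep_mul, h, freeRep_ι]; rfl
  | g_tgt i =>
    have h : ∀ i : ZMod 1, pathMul (genPath (Gen.e (gTgt 1 i))) (genPath (Gen.g i)) =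
        some (genPath (Gen.g i)) := by decide +kernel
    rw [E, G, freeRep_mul, h, freeRep_ι]; rfl
  | g_src i =>
    have h : ∀ i : ZMod 1, pathMul (genPath (Gen.g i)) (genPath (Gen.e (gSrc 1 i))) =
        some (genPath (Gen.g i)) := by decide +kernel
    rw [E, G, freeRep_mul, h, freeRep_ι]; rfl
  | len5 x₁ x₂ x₃ x₄ x₅ h₁ h₂ h₃ h₄ h₅ =>
    have h0 : ∃ y, freeRep K x₅ = leftOpt K y ∧ ∀ r ∈ y, len r = 1 := by
      obtain ⟨p, -, hp, h⟩ := freeRep_arrow K x₅ h₅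
      exact ⟨some p, h, fun r hr => by rw [← Option.some_inj.1 hr, hp]⟩
    obtain ⟨y, hy, h⟩ := freeRep_arrow_mul K x₁ h₁ _ _ <| freeRep_arrow_mul K x₂ h₂ _ _ <|
      freeRep_arrow_mul K x₃ h₃ _ _ <| freeRep_arrow_mul K x₄ h₄ _ _ h0
    rw [map_zero]
    simp only [map_mul, mul_assoc]
    rw [hy]
    cases y with
    | none => rfl
    | some r => exact absurd (h r rfl) (by have := len_le r; omega)
  | comm t =>
    rw [A, A, A, B, B, B, freeRep_mul_mul, freeRep_mul_mul]
    refine congrArg _ ?_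
    revert t; decide +kernel
  | zero_agb t =>
    rw [A, G, B, freeRep_mul_mul, map_zero]
    refine (congrArg (leftOpt K) (?_ : _ = none)).trans rfl
    revert t; decide +kernel
  | zero_bga t =>
    rw [B, G, A, freeRep_mul_mul, map_zero]
    refine (congrArg (leftOpt K) (?_ : _ = none)).trans rfl
    revert t; decide +kernel

/-- The left regular representation of `R_1` in terms of paths. -/
noncomputable def pathRep : Alg K 1 →ₐ[K] Module.End K (Pth →₀ K) :=
  RingQuot.liftAlgHom K ⟨freeRep K, fun _ _ h => freeRep_rel K h⟩

theorem genPath_letter : ∀ p : Pth, p.val < 13 → genPath (letter p.val) = p := by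
  decide

theorem pathRep_pathElem (p : Pth) : pathRep K (pathElem K p) = leftPath K p := by
  induction p using WellFoundedLT.induction with
  | _ p ih =>
  rcases lt_or_ge p.val 13 with h | h
  · rw [pathElem_of_lt K p h, pathRep]
    refine (RingQuot.liftAlgHom_mkAlgHom_apply _ _ _ _).trans ?_
    rw [freeLetter, freeRep_ι, genPath_letter p h]
  · obtain ⟨a, p', ha, -, hlt, -, hm, -⟩ := word_cons p h
    have hp : pathElem K p = pathElem K a * pathElem K p' := by
      rw [letter_mul K a ha, hm]; rfl
    rw [hp, map_mul, ih p' hlt, ih a (Fin.lt_def.2 (lt_of_lt_of_le ha h)), leftPath_mul K a ha, hm]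
    rfl

theorem linearIndependent_pathElem : LinearIndependent K (pathElem K) := by
  let f : Alg K 1 →ₗ[K] (Pth →₀ K) :=
    (LinearMap.applyₗ (∑ i : Fin 6, Finsupp.single (triv i) (1 : K))).comp (pathRep K).toLinearMap
  have hf : f ∘ pathElem K = fun p => Finsupp.single p 1 := by
    funext p
    change pathRep K (pathElem K p) (∑ i : Fin 6, Finsupp.single (triv i) (1 : K)) = _
    rw [pathRep_pathElem, map_sum]
    have h : ∀ i : Fin 6, leftPath K p (Finsupp.single (triv i) 1) =
        if i = src p then Finsupp.single p 1 else 0 := by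
      intro i
      rw [leftPath_single, pathMul_triv]
      split_ifs <;> rfl
    exact (Finset.sum_congr rfl fun i _ => h i).trans (by simp)
  refine LinearIndependent.of_comp f ?_
  rw [hf]
  exact Finsupp.linearIndependent_single_one K Pth

/-- The basis of `R_1` given by the nonzero paths. -/
noncomputable def pathBasis : Module.Basis Pth K (Alg K 1) :=
  Module.Basis.mk (linearIndependent_pathElem K) (span_pathElem K).ge

theorem pathBasis_apply (p : Pth) : pathBasis K p = pathElem K p :=
  Module.Basis.mk_apply _ _ p

/-- The character of the free algebra at a vertex. -/
noncomputable def freeChar (i : Fin 6) : F K 1 →ₐ[K] K :=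
  FreeAlgebra.lift K fun x => if genPath x = triv i then 1 else 0

theorem freeChar_ι (i : Fin 6) (x : Gen 1) :
    freeChar K i (FreeAlgebra.ι K x) = if genPath x = triv i then 1 else 0 :=
  FreeAlgebra.lift_ι_apply _ _

theorem freeChar_arrow (i : Fin 6) (x : F K 1) (hx : x ∈ arrows K 1) : freeChar K i x = 0 := by
  rcases hx with (⟨j, rfl⟩ | ⟨j, rfl⟩) | ⟨j, rfl⟩
  · exact (freeChar_ι K i _).trans (if_neg (by revert i j; decide))
  · exact (freeChar_ι K i _).trans (if_neg (by revert i j; decide))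
  · exact (freeChar_ι K i _).trans (if_neg (by revert i j; decide))

theorem freeChar_rel (k : Fin 6) {x y : F K 1} (h : Rel K 1 x y) :
    freeChar K k x = freeChar K k y := by
  have ha (j) : freeChar K k (A K 1 j) = 0 := freeChar_arrow K k _ (Or.inl (Or.inl ⟨j, rfl⟩))
  have hb (j) : freeChar K k (B K 1 j) = 0 := freeChar_arrow K k _ (Or.inl (Or.inr ⟨j, rfl⟩))
  have hg (j) : freeChar K k (G K 1 j) = 0 := freeChar_arrow K k _ (Or.inr ⟨j, rfl⟩)
  induction h with
  | idem i j =>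
    have h : ∀ i j : ZMod (6 * 1), genPath (Gen.e i) = triv k → genPath (Gen.e j) = triv k →
        i = j := by clear ha hb hg; revert k; decide
    rw [map_mul, E, E, freeChar_ι, freeChar_ι]
    by_cases hij : i = j
    · subst hij
      rw [if_pos rfl, freeChar_ι]
      split_ifs <;> simp
    · rw [if_neg hij, map_zero]
      split_ifs with h1 h2
      · exact absurd (h i j h1 h2) hij
      all_goals simp
  | sum_one =>
    rw [map_sum, map_one, Finset.sum_range]
    have h : ∀ i : Fin 6, freeChar K k (E K 1 (i.val : ZMod (6 * 1))) =
        if i = k then 1 else 0 := by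
      intro i
      have hi : genPath (Gen.e (i.val : ZMod (6 * 1))) = triv k ↔ i = k := by
        clear ha hb hg; revert i k; decide
      rw [E, freeChar_ι]
      simp only [hi]
    exact (Finset.sum_congr rfl fun i _ => h i).trans (by simp)
  | a_tgt | a_src | b_tgt | b_src | g_tgt | g_src | comm | zero_agb | zero_bga =>
    simp only [map_mul, map_zero, ha, hb, hg, mul_zero, zero_mul]
  | len5 x₁ x₂ x₃ x₄ x₅ h₁ =>
    simp only [map_mul, freeChar_arrow K k x₁ h₁, zero_mul, map_zero]

/-- The character of `R_1` at a vertex. -/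
noncomputable def vchar (i : Fin 6) : Alg K 1 →ₐ[K] K :=
  RingQuot.liftAlgHom K ⟨freeChar K i, fun _ _ h => freeChar_rel K i h⟩

theorem vchar_pathElem (i : Fin 6) (p : Pth) :
    vchar K i (pathElem K p) = if p = triv i then 1 else 0 := by
  have key (p : Pth) (h : p.val < 13) :
      vchar K i (pathElem K p) = if p = triv i then 1 else 0 := by
    rw [pathElem_of_lt K p h, vchar]
    refine (RingQuot.liftAlgHom_mkAlgHom_apply _ _ _ _).trans ?_
    rw [freeLetter, freeChar_ι, genPath_letter p h]
  rcases lt_or_ge p.val 13 with h | h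
  · exact key p h
  · obtain ⟨a, p', ha, ha6, -, -, hm, -⟩ := word_cons p h
    have hp : pathElem K p = pathElem K a * pathElem K p' := by
      rw [letter_mul K a ha, hm]; rfl
    have hne (q : Pth) (hq : 6 ≤ q.val) : q ≠ triv i := by
      rintro rfl
      exact absurd i.isLt (not_lt.2 hq)
    rw [hp, map_mul, key a ha, if_neg (hne a ha6), zero_mul, if_neg (hne p (by omega))]
theorem pathBasis_repr_optElem (x : Option Pth) (p : Pth) :
    (pathBasis K).repr (optElem K x) p = if x = some p then 1 else 0 := by
  cases x with
  | none => simp [optElem]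
  | some r =>
    change (pathBasis K).repr (pathElem K r) p = _
    rw [← pathBasis_apply, Module.Basis.repr_self, Finsupp.single_apply]
    simp only [Option.some_inj]

theorem pathBasis_repr_mul_left (a x : Alg K 1) (p : Pth)
    (hx : ∀ q < p, (pathBasis K).repr x q = 0) :
    (pathBasis K).repr (a * x) p = vchar K (tgt p) a * (pathBasis K).repr x p := by
  have key : ((pathBasis K).coord p) ∘ₗ LinearMap.mulRight K x =
      (pathBasis K).repr x p • (vchar K (tgt p)).toLinearMap := by
    refine (pathBasis K).ext fun m => ?_
    change (pathBasis K).repr (pathBasis K m * x) p =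
      (pathBasis K).repr x p * vchar K (tgt p) (pathBasis K m)
    rw [pathBasis_apply, vchar_pathElem]
    conv_lhs => rw [← (pathBasis K).sum_repr x]
    simp only [pathBasis_apply, Finset.mul_sum, mul_smul_comm, pathElem_mul, map_sum, map_smul,
      Finsupp.coe_finsetSum, Finset.sum_apply, Finsupp.smul_apply, pathBasis_repr_optElem,
      smul_eq_mul]
    rw [Finset.sum_eq_single p]
    · congr 1
      refine if_congr ⟨fun h => ?_, ?_⟩ rfl rfl
      · exact ((pathMul_gt_or_left m p p h).resolve_left (lt_irrefl _)).2
      · rintro rfl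
        rw [triv_pathMul, if_pos rfl]
    · intro q _ hq
      split_ifs with h
      · rw [hx q ((pathMul_gt_or_left m q p h).resolve_right fun h' => hq h'.1.symm), zero_mul]
      · exact mul_zero _
    · exact fun h => absurd (Finset.mem_univ _) h
  exact (LinearMap.congr_fun key a).trans (mul_comm _ _)

theorem pathBasis_repr_mul_right (a x : Alg K 1) (p : Pth)
    (hx : ∀ q < p, (pathBasis K).repr x q = 0) :
    (pathBasis K).repr (x * a) p = vchar K (src p) a * (pathBasis K).repr x p := by
  have key : ((pathBasis K).coord p) ∘ₗ LinearMap.mulLeft K x =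
      (pathBasis K).repr x p • (vchar K (src p)).toLinearMap := by
    refine (pathBasis K).ext fun m => ?_
    change (pathBasis K).repr (x * pathBasis K m) p =
      (pathBasis K).repr x p * vchar K (src p) (pathBasis K m)
    rw [pathBasis_apply, vchar_pathElem]
    conv_lhs => rw [← (pathBasis K).sum_repr x]
    simp only [pathBasis_apply, Finset.sum_mul, smul_mul_assoc, pathElem_mul, map_sum, map_smul,
      Finsupp.coe_finsetSum, Finset.sum_apply, Finsupp.smul_apply, pathBasis_repr_optElem,
      smul_eq_mul]
    rw [Finset.sum_eq_single p]
    · congr 1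
      refine if_congr ⟨fun h => ?_, ?_⟩ rfl rfl
      · exact ((pathMul_gt_or_right m p p h).resolve_left (lt_irrefl _)).2
      · rintro rfl
        rw [pathMul_triv, if_pos rfl]
    · intro q _ hq
      split_ifs with h
      · rw [hx q ((pathMul_gt_or_right m q p h).resolve_right fun h' => hq h'.1.symm), zero_mul]
      · exact mul_zero _
    · exact fun h => absurd (Finset.mem_univ _) h
  exact (LinearMap.congr_fun key a).trans (mul_comm _ _)
theorem rank_hom_alg {Q : Type u} [AddCommGroup Q] [Module (Env K 1) Q]
    [Module.Projective (Env K 1) Q] :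
    Module.rank K (Q →ₗ[Env K 1] Alg K 1) = ∑ p : Pth, Module.rank K
      (Q →ₗ[Env K 1] Dual (vchar K (tgt p)) (Chr (vchar K (src p)))) :=
  rank_hom_eq_sum (vchar K) (pathBasis K) src tgt (pathBasis_repr_mul_left K)
    (pathBasis_repr_mul_right K)

end Structure
/-! ### Periodic complexes of projective modules -/

/-- The vertices of the indecomposable summands of the terms of two periodic complexes of
projective modules: the terms `0, …, 10` form a complex of period `11`, and the terms
`11, …, 32` form a complex of period `22`. -/
def vertexTable : List (List (Fin 6)) :=
  [[5], [0], [0], [1, 3], [5], [2, 4], [5, 0], [1, 3], [0], [2, 4], [5], [1], [2], [2], [5], [3],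
   [0], [1, 4], [5], [2], [0], [3], [3], [4], [4], [5], [1], [0], [3, 2], [5], [4], [0], [1]]

/-- The rows of the matrices of the differentials; an entry `(c, m, q)` stands for `c` times the
path `q` in column `m`. -/
def rowTable : List (List (List (ℤ × Fin 2 × Pth))) :=
  [[[(1, 0, 12)]], [[(1, 0, 28)]], [[(1, 0, 6)], [(1, 0, 9)]], [[(-1, 0, 15), (1, 1, 17)]],
   [[(1, 0, 26)], [(1, 0, 27)]], [[(-1, 0, 8), (1, 1, 11)], [(1, 0, 16)]],
   [[(1, 0, 19), (1, 1, 6)], [(1, 1, 9)]], [[(-1, 0, 22), (1, 1, 24)]],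
   [[(1, 0, 13)], [(1, 0, 14)]], [[(-1, 0, 8), (1, 1, 11)]], [[(1, 0, 33)]], [[(1, 0, 7)]],
   [[(1, 0, 30)]], [[(1, 0, 8)]], [[(1, 0, 20)]], [[(1, 0, 24)]], [[(1, 0, 6)], [(1, 0, 14)]],
   [[(-1, 0, 15), (1, 1, 11)]], [[(1, 0, 26)]], [[(1, 0, 16)]], [[(1, 0, 9)]], [[(1, 0, 31)]],
   [[(1, 0, 10)]], [[(1, 0, 32)]], [[(1, 0, 11)]], [[(1, 0, 19)]], [[(1, 0, 22)]],
   [[(1, 0, 9)], [(1, 0, 13)]], [[(-1, 0, 17), (1, 1, 8)]], [[(1, 0, 27)]], [[(1, 0, 18)]],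
   [[(1, 0, 6)]], [[(1, 0, 29)]]]

/-- Contracting homotopies of the complexes: `((l, p), T)` says that `p` in the component `l` is
sent to `T`. -/
def homotopyTable : List (List ((Fin 2 × Pth) × List (ℤ × Fin 2 × Pth))) :=
  [[((0, 12), [(1, 0, 0)]), ((0, 19), [(1, 0, 6)]), ((0, 20), [(1, 0, 9)]),
    ((0, 26), [(1, 0, 13)]), ((0, 27), [(1, 0, 14)]), ((0, 33), [(1, 0, 21)])],
   [((0, 28), [(1, 0, 0)])],
   [((0, 6), [(1, 0, 1)]), ((0, 9), [(1, 1, 3)]), ((0, 13), [(1, 0, 7)]),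
    ((0, 14), [(1, 1, 10)]), ((0, 21), [(1, 0, 15)]), ((0, 28), [(1, 0, 22)])],
   [((0, 29), [(-1, 0, 19)]), ((1, 17), [(1, 0, 5)]), ((1, 24), [(1, 0, 12)]),
    ((1, 31), [(1, 0, 20)])],
   [((0, 26), [(1, 0, 2)]), ((0, 27), [(1, 1, 4)]), ((0, 33), [(1, 0, 8)])],
   [((0, 16), [(1, 1, 0)]), ((0, 23), [(-1, 0, 19)]), ((0, 30), [(-1, 0, 26)]),
    ((1, 11), [(1, 0, 5)]), ((1, 18), [(1, 0, 12), (1, 1, 0)]), ((1, 25), [(1, 0, 20)]),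
    ((1, 32), [(1, 0, 27)])],
   [((0, 33), [(1, 0, 15), (-1, 1, 17)]), ((1, 6), [(1, 0, 1)]), ((1, 9), [(1, 1, 3)]),
    ((1, 13), [(1, 0, 7)]), ((1, 14), [(1, 1, 10)]), ((1, 21), [(1, 1, 17)]),
    ((1, 28), [(1, 0, 22)])],
   [((0, 29), [(-1, 0, 6)]), ((1, 24), [(1, 0, 0)]), ((1, 31), [(1, 0, 9)])],
   [((0, 13), [(1, 0, 2)]), ((0, 14), [(1, 1, 4)]), ((0, 21), [(1, 0, 8)]),
    ((0, 28), [(1, 0, 16)])],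
   [((0, 23), [(-1, 0, 19)]), ((0, 30), [(-1, 0, 26)]), ((1, 11), [(1, 0, 5)]),
    ((1, 18), [(1, 0, 12)]), ((1, 25), [(1, 0, 20)]), ((1, 32), [(1, 0, 27)])],
   [((0, 33), [(1, 0, 5)])],
   [((0, 7), [(1, 0, 2)]), ((0, 15), [(1, 0, 8)]), ((0, 22), [(1, 0, 16)]),
    ((0, 29), [(1, 0, 23)])],
   [((0, 30), [(1, 0, 2)])],
   [((0, 8), [(1, 0, 5)]), ((0, 16), [(1, 0, 12)]), ((0, 23), [(1, 0, 19)]),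
    ((0, 30), [(1, 0, 26)])],
   [((0, 20), [(1, 0, 3)]), ((0, 27), [(1, 0, 10)]), ((0, 33), [(1, 0, 17)])],
   [((0, 24), [(1, 0, 0)]), ((0, 31), [(1, 0, 9)])],
   [((0, 6), [(1, 0, 1)]), ((0, 13), [(1, 0, 7)]), ((0, 14), [(1, 1, 4)]),
    ((0, 21), [(1, 0, 15)]), ((0, 28), [(1, 0, 22)])],
   [((0, 29), [(-1, 0, 19)]), ((1, 11), [(1, 0, 5)]), ((1, 18), [(1, 0, 12)]),
    ((1, 25), [(1, 0, 20)]), ((1, 32), [(1, 0, 27)])],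
   [((0, 26), [(1, 0, 2)]), ((0, 33), [(1, 0, 8)])],
   [((0, 16), [(1, 0, 0)]), ((0, 23), [(1, 0, 6)]), ((0, 30), [(1, 0, 13)])],
   [((0, 9), [(1, 0, 3)]), ((0, 14), [(1, 0, 10)]), ((0, 21), [(1, 0, 17)]),
    ((0, 28), [(1, 0, 24)])],
   [((0, 31), [(1, 0, 3)])],
   [((0, 10), [(1, 0, 4)]), ((0, 17), [(1, 0, 11)]), ((0, 24), [(1, 0, 18)]),
    ((0, 31), [(1, 0, 25)])],
   [((0, 32), [(1, 0, 4)])],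
   [((0, 11), [(1, 0, 5)]), ((0, 18), [(1, 0, 12)]), ((0, 25), [(1, 0, 20)]),
    ((0, 32), [(1, 0, 27)])],
   [((0, 19), [(1, 0, 1)]), ((0, 26), [(1, 0, 7)]), ((0, 33), [(1, 0, 15)])],
   [((0, 22), [(1, 0, 0)]), ((0, 29), [(1, 0, 6)])],
   [((0, 9), [(1, 0, 3)]), ((0, 13), [(1, 1, 2)]), ((0, 14), [(1, 0, 10)]),
    ((0, 21), [(1, 0, 17)]), ((0, 28), [(1, 0, 24)])],
   [((0, 31), [(-1, 0, 20)]), ((1, 8), [(1, 0, 5)]), ((1, 16), [(1, 0, 12)]),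
    ((1, 23), [(1, 0, 19)]), ((1, 30), [(1, 0, 26)])],
   [((0, 27), [(1, 0, 4)]), ((0, 33), [(1, 0, 11)])],
   [((0, 18), [(1, 0, 0)]), ((0, 25), [(1, 0, 9)]), ((0, 32), [(1, 0, 14)])],
   [((0, 6), [(1, 0, 1)]), ((0, 13), [(1, 0, 7)]), ((0, 21), [(1, 0, 15)]),
    ((0, 28), [(1, 0, 22)])],
   [((0, 29), [(1, 0, 1)])]]

/-- Indices of the terms of the two complexes. -/
abbrev Pos : Type := Fin 33

/-- The next term. -/
def next (σ : Pos) : Pos := if σ = 10 then 0 else if σ = 32 then 11 else Fin.ofNat 33 (σ.val + 1)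

/-- Formal integral combinations of paths in two components. -/
abbrev Comb : Type := List (ℤ × Fin 2 × Pth)

/-- The vertex of the `l`-th summand of a term. -/
def vtx (σ : Pos) (l : Fin 2) : Option (Fin 6) := (vertexTable.getD σ.val [])[l.val]?

/-- The `l`-th row of the differential from the term `next σ` to the term `σ`. -/
def row (σ : Pos) (l : Fin 2) : Comb := (rowTable.getD σ.val []).getD l.val []

/-- The homotopy from the term `σ` to the term `next σ`. -/
def homotopy (σ : Pos) (x : Fin 2 × Pth) : Comb :=
  ((homotopyTable.getD σ.val []).lookup x).getD []

/-- Left multiplication of a combination by a path. -/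
def pathSmul (p : Pth) (T : Comb) : Comb :=
  T.filterMap fun t => (pathMul p t.2.2).map fun r => (t.1, t.2.1, r)

/-- Linear extension of a function on basis elements. -/
def extend (f : Fin 2 × Pth → Comb) (T : Comb) : Comb :=
  T.flatMap fun t => (f t.2).map fun t' => (t.1 * t'.1, t'.2)

/-- The differential on basis elements. -/
def rowMap (σ : Pos) (x : Fin 2 × Pth) : Comb := pathSmul x.2 (row σ x.1)

/-- The coefficient of a basis element in a combination. -/
def coeff (T : Comb) (x : Fin 2 × Pth) : ℤ := (T.map fun t => if t.2 = x then t.1 else 0).sum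

/-- Whether all coefficients of a combination vanish. -/
def vanishes (T : Comb) : Bool := T.all fun t => coeff T t.2 == 0

theorem homotopy_identity : ∀ (σ : Pos) (l : Fin 2), ∀ i ∈ vtx (next σ) l,
    ∀ p : Pth, src p = i → vanishes ((-1, l, p) ::
      (extend (rowMap (next σ)) (homotopy (next σ) (l, p)) ++
        extend (homotopy σ) (rowMap σ (l, p)))) = true := by
  decide +kernel

theorem vanishes_extend_row : ∀ (σ : Pos) (l : Fin 2),
    vanishes (extend (rowMap σ) (row (next σ) l)) = true := by
  decide +kernel

theorem mem_row : ∀ (σ : Pos) (l : Fin 2), ∀ t ∈ row σ l, vtx (next σ) l = some (tgt t.2.2) ∧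
    vtx σ t.2.1 = some (src t.2.2) ∧ 6 ≤ t.2.2.val := by
  decide +kernel

/-- The iterates of `next`. -/
def orbit (σ : Pos) : ℕ → Pos
  | 0 => σ
  | k + 1 => next (orbit σ k)

theorem orbit_add (σ : Pos) (m n : ℕ) : orbit σ (m + n) = orbit (orbit σ m) n := by
  induction n with
  | zero => rfl
  | succ n ih => exact congrArg next ih

theorem orbit_period : ∀ σ : Pos, orbit σ 22 = σ := by
  decide +kernel

theorem orbit_mod (σ : Pos) (t : ℕ) : orbit σ t = orbit σ (t % 22) := by
  induction t using Nat.strong_induction_on with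
  | _ t ih =>
  rcases lt_or_ge t 22 with h | h
  · rw [Nat.mod_eq_of_lt h]
  · obtain ⟨m, rfl⟩ := Nat.exists_eq_add_of_le h
    rw [orbit_add, orbit_period, ih m (by omega), Nat.add_mod_left]

/-- The term at which the coresolution of the simple module at a vertex is found. -/
def start (j : Fin 6) : Pos := [2, 11, 13, 22, 24, 0].getD j.val 0

/-- The term before `start`. -/
def before (j : Fin 6) : Pos := [1, 32, 12, 21, 23, 10].getD j.val 0

/-- The socle path at a vertex. -/
def loop (j : Fin 6) : Pth := Fin.ofNat 34 (28 + j.val)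

theorem next_before : ∀ j : Fin 6, next (before j) = start j := by
  decide +kernel

theorem row_before : ∀ j : Fin 6, row (before j) 0 = [(1, 0, loop j)] ∧ row (before j) 1 = [] := by
  decide +kernel

theorem vtx_start : ∀ j : Fin 6, vtx (start j) 0 = some j ∧ vtx (start j) 1 = none := by
  decide +kernel

theorem pathMul_loop : ∀ (j : Fin 6) (p : Pth),
    pathMul p (loop j) = if p = triv j then some (loop j) else none := by
  decide +kernel

theorem sum_vtx_eq_homDim1 : ∀ t : Fin 22, ∑ p : Pth,
    (Finset.univ.filter fun l => vtx (orbit (start (src p)) t.val) l = some (tgt p)).card =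
      homDim1 t.val := by
  decide +kernel

theorem homDim1_mod (t : ℕ) : homDim1 t = homDim1 (t % 22) := by
  have h1 : t / 11 % 2 = t % 22 / 11 % 2 := by omega
  have h2 : t % 22 % 11 = t % 11 := by omega
  simp only [homDim1, h1, h2]

section Complexes

variable (K : Type u) [Field K]

/-- A basis element of `R_1 ⊕ R_1`. -/
noncomputable def basisVec (x : Fin 2 × Pth) : Fin 2 → Alg K 1 := Pi.single x.1 (pathElem K x.2)

/-- The element of `R_1 ⊕ R_1` given by a combination. -/
noncomputable def eval (T : Comb) : Fin 2 → Alg K 1 :=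
  (T.map fun t => (t.1 : K) • basisVec K t.2).sum

theorem eval_nil : eval K [] = 0 := rfl

theorem eval_cons (t : ℤ × Fin 2 × Pth) (T : Comb) :
    eval K (t :: T) = (t.1 : K) • basisVec K t.2 + eval K T := by
  rw [eval, List.map_cons, List.sum_cons]; rfl

theorem eval_append (S T : Comb) : eval K (S ++ T) = eval K S + eval K T := by
  rw [eval, List.map_append, List.sum_append]; rfl

theorem eval_eq_sum (T : Comb) : eval K T = ∑ x, (coeff T x : K) • basisVec K x := by
  induction T with
  | nil => simp [eval_nil, coeff]
  | cons t T ih =>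
    have h : ∀ x, coeff (t :: T) x = (if t.2 = x then t.1 else 0) + coeff T x := fun x => by
      rw [coeff, List.map_cons, List.sum_cons]; rfl
    simp only [eval_cons, ih, h, Int.cast_add, add_smul, Finset.sum_add_distrib]
    refine congrArg (· + _) ?_
    rw [Finset.sum_eq_single t.2
      (fun x _ hx => by rw [if_neg (Ne.symm hx), Int.cast_zero, zero_smul])
      fun h => absurd (Finset.mem_univ _) h, if_pos rfl]

theorem eval_eq_zero (T : Comb) (h : vanishes T = true) : eval K T = 0 := by
  rw [eval_eq_sum]
  refine Finset.sum_eq_zero fun x _ => ?_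
  have hx : coeff T x = 0 := by
    by_cases hx : ∃ t ∈ T, t.2 = x
    · obtain ⟨t, ht, rfl⟩ := hx
      exact eq_of_beq (List.all_eq_true.1 h t ht)
    · refine List.sum_eq_zero fun n hn => ?_
      obtain ⟨t, ht, rfl⟩ := List.mem_map.1 hn
      exact if_neg fun h' => hx ⟨t, ht, h'⟩
  rw [hx, Int.cast_zero, zero_smul]

theorem pathElem_smul_basisVec (p : Pth) (x : Fin 2 × Pth) :
    pathElem K p • basisVec K x = (pathMul p x.2).elim 0 fun r => basisVec K (x.1, r) := by
  rw [basisVec, ← Pi.single_smul, smul_eq_mul, pathElem_mul]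
  cases pathMul p x.2 with
  | none => exact Pi.single_zero _
  | some r => rfl

theorem pathElem_smul_eval (p : Pth) (T : Comb) :
    pathElem K p • eval K T = eval K (pathSmul p T) := by
  induction T with
  | nil => exact smul_zero _
  | cons t T ih =>
    rw [eval_cons, smul_add, ih, smul_comm, pathElem_smul_basisVec, pathSmul, pathSmul,
      List.filterMap_cons]
    cases pathMul p t.2.2 with
    | none => simp
    | some r => simp [eval_cons]

theorem eval_map_mul (c : ℤ) (T : Comb) :
    eval K (T.map fun t => (c * t.1, t.2)) = (c : K) • eval K T := by
  induction T with
  | nil => exact (smul_zero _).symm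
  | cons t T ih => rw [List.map_cons, eval_cons, ih, eval_cons, smul_add, smul_smul, Int.cast_mul]

theorem map_eval (g : (Fin 2 → Alg K 1) →ₗ[K] (Fin 2 → Alg K 1)) (f : Fin 2 × Pth → Comb)
    (hg : ∀ x, g (basisVec K x) = eval K (f x)) (T : Comb) :
    g (eval K T) = eval K (extend f T) := by
  induction T with
  | nil => exact map_zero g
  | cons t T ih =>
    rw [eval_cons, map_add, map_smul, hg, ih, extend, extend, List.flatMap_cons, eval_append,
      eval_map_mul]

/-- Linear maps out of `R_1 ⊕ R_1` are determined by their values on basis elements. -/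
theorem ext_basisVec {V : Type*} [AddCommGroup V] [Module K V] {f g : (Fin 2 → Alg K 1) →ₗ[K] V}
    (h : ∀ x, f (basisVec K x) = g (basisVec K x)) : f = g := by
  refine LinearMap.pi_ext' fun l => (pathBasis K).ext fun p => ?_
  rw [pathBasis_apply]
  exact h (l, p)

/-- The linear map sending basis elements to given combinations. -/
noncomputable def ofComb (f : Fin 2 × Pth → Comb) :
    (Fin 2 → Alg K 1) →ₗ[K] (Fin 2 → Alg K 1) :=
  ∑ l, ((pathBasis K).constr K fun p => eval K (f (l, p))).comp (LinearMap.proj l)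

theorem ofComb_basisVec (f : Fin 2 × Pth → Comb) (x : Fin 2 × Pth) :
    ofComb K f (basisVec K x) = eval K (f x) := by
  rw [ofComb, LinearMap.sum_apply, Finset.sum_eq_single x.1]
  · rw [LinearMap.comp_apply, LinearMap.proj_apply, basisVec, Pi.single_eq_same,
      ← pathBasis_apply, Module.Basis.constr_basis]
  · intro l _ hl
    rw [LinearMap.comp_apply, LinearMap.proj_apply, basisVec, Pi.single_eq_of_ne hl, map_zero]
  · exact fun h => absurd (Finset.mem_univ _) h

/-- The idempotent of the `l`-th summand of a term. -/
noncomputable def idem (σ : Pos) (l : Fin 2) : Alg K 1 := optElem K ((vtx σ l).map triv)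

theorem pathElem_mul_idem (σ : Pos) (l : Fin 2) (p : Pth) :
    pathElem K p * idem K σ l = if vtx σ l = some (src p) then pathElem K p else 0 := by
  rw [idem]
  cases vtx σ l with
  | none => exact mul_zero _
  | some i =>
    refine (pathElem_mul K p (triv i)).trans ?_
    rw [pathMul_triv]
    simp only [Option.some_inj]
    split_ifs <;> rfl

theorem idem_mul_self (σ : Pos) (l : Fin 2) : idem K σ l * idem K σ l = idem K σ l := by
  rw [idem]
  cases vtx σ l with
  | none => exact mul_zero _
  | some i => exact (pathElem_triv_mul_triv K i i).trans (if_pos rfl)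

theorem vchar_idem (i : Fin 6) (σ : Pos) (l : Fin 2) :
    vchar K i (idem K σ l) = if vtx σ l = some i then 1 else 0 := by
  rw [idem]
  cases vtx σ l with
  | none => exact map_zero _
  | some j =>
    refine (vchar_pathElem K i (triv j)).trans ?_
    refine if_congr ⟨fun h => ?_, fun h => ?_⟩ rfl rfl
    · exact congrArg some (Fin.castLE_injective _ h)
    · exact congrArg triv (Option.some_inj.1 h)

/-- The terms of the complexes. -/
noncomputable def term (σ : Pos) : Submodule (Alg K 1) (Fin 2 → Alg K 1) where
  carrier := {f | ∀ l, f l * idem K σ l = f l}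
  add_mem' := fun {f g} hf hg l => by rw [Pi.add_apply, add_mul, hf, hg]
  zero_mem' := fun l => zero_mul _
  smul_mem' := fun a f hf l => by rw [Pi.smul_apply, smul_mul_assoc, hf]

/-- The projection onto a term. -/
noncomputable def termProj (σ : Pos) : (Fin 2 → Alg K 1) →ₗ[K] (Fin 2 → Alg K 1) :=
  LinearMap.pi fun l => (LinearMap.mulRight K (idem K σ l)).comp (LinearMap.proj l)

theorem termProj_apply (σ : Pos) (f : Fin 2 → Alg K 1) (l : Fin 2) :
    termProj K σ f l = f l * idem K σ l := rfl

theorem termProj_mem (σ : Pos) (f : Fin 2 → Alg K 1) : termProj K σ f ∈ term K σ := fun l => by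
  rw [termProj_apply, mul_assoc, idem_mul_self]

theorem termProj_eq_self (σ : Pos) {f : Fin 2 → Alg K 1} (hf : f ∈ term K σ) :
    termProj K σ f = f := funext hf

theorem termProj_basisVec (σ : Pos) (x : Fin 2 × Pth) :
    termProj K σ (basisVec K x) = if vtx σ x.1 = some (src x.2) then basisVec K x else 0 := by
  funext l
  rw [termProj_apply, basisVec]
  by_cases hl : l = x.1
  · subst hl
    rw [Pi.single_eq_same, pathElem_mul_idem]
    split_ifs
    · rw [Pi.single_eq_same]
    · rfl
  · rw [Pi.single_eq_of_ne hl, zero_mul]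
    split_ifs
    · rw [Pi.single_eq_of_ne hl]
    · rfl

/-- The differential on `R_1 ⊕ R_1`. -/
noncomputable def diff (σ : Pos) : (Fin 2 → Alg K 1) →ₗ[Alg K 1] (Fin 2 → Alg K 1) :=
  ∑ l, (LinearMap.toSpanSingleton (Alg K 1) (Fin 2 → Alg K 1) (eval K (row σ l))).comp
    (LinearMap.proj l)

theorem diff_apply (σ : Pos) (f : Fin 2 → Alg K 1) :
    diff K σ f = ∑ l, f l • eval K (row σ l) := by
  rw [diff, LinearMap.sum_apply]; rfl

theorem diff_basisVec (σ : Pos) (x : Fin 2 × Pth) :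
    diff K σ (basisVec K x) = eval K (rowMap σ x) := by
  rw [diff_apply, Finset.sum_eq_single x.1, basisVec, Pi.single_eq_same, pathElem_smul_eval]
  · rfl
  · intro l _ hl
    rw [basisVec, Pi.single_eq_of_ne hl, zero_smul]
  · exact fun h => absurd (Finset.mem_univ _) h

theorem basisVec_mem (σ : Pos) (x : Fin 2 × Pth) (h : vtx σ x.1 = some (src x.2)) :
    basisVec K x ∈ term K σ := by
  have h' := termProj_mem K σ (basisVec K x)
  rwa [termProj_basisVec, if_pos h] at h'

theorem eval_row_mem (σ : Pos) (l : Fin 2) : eval K (row σ l) ∈ term K σ := by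
  refine list_sum_mem fun v hv => ?_
  obtain ⟨t, ht, rfl⟩ := List.mem_map.1 hv
  rw [← algebraMap_smul (Alg K 1)]
  exact Submodule.smul_mem _ _ (basisVec_mem K σ t.2 (mem_row σ l t ht).2.1)

theorem diff_mem (σ : Pos) (f : Fin 2 → Alg K 1) : diff K σ f ∈ term K σ := by
  rw [diff_apply]
  exact Submodule.sum_mem _ fun l _ => Submodule.smul_mem _ _ (eval_row_mem K σ l)

theorem idem_smul_eval_row (σ : Pos) (l : Fin 2) :
    idem K (next σ) l • eval K (row σ l) = eval K (row σ l) := by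
  rw [eval, List.smul_sum, List.map_map]
  congr 1
  refine List.map_congr_left fun t ht => ?_
  have h := (mem_row σ l t ht).1
  rw [Function.comp_apply, idem, h]
  change pathElem K (triv (tgt t.2.2)) • ((t.1 : K) • basisVec K t.2) = _
  rw [smul_comm, pathElem_smul_basisVec, triv_pathMul, if_pos rfl]
  rfl

theorem diff_termProj (σ : Pos) (f : Fin 2 → Alg K 1) :
    diff K σ (termProj K (next σ) f) = diff K σ f := by
  rw [diff_apply, diff_apply]
  refine Finset.sum_congr rfl fun l _ => ?_
  rw [termProj_apply, mul_smul, idem_smul_eval_row]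

theorem diff_diff (σ : Pos) (f : Fin 2 → Alg K 1) : diff K σ (diff K (next σ) f) = 0 := by
  rw [diff_apply K (next σ), map_sum]
  refine Finset.sum_eq_zero fun l _ => ?_
  rw [map_smul]
  have := map_eval K ((diff K σ).restrictScalars K) (rowMap σ) (diff_basisVec K σ) (row (next σ) l)
  rw [LinearMap.restrictScalars_apply] at this
  rw [this, eval_eq_zero K _ (vanishes_extend_row σ l), smul_zero]

theorem eq_diff_homotopy_add (σ : Pos) {f : Fin 2 → Alg K 1} (hf : f ∈ term K (next σ)) :
    f = diff K (next σ) (ofComb K (homotopy (next σ)) f) + ofComb K (homotopy σ) (diff K σ f) := by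
  have key : termProj K (next σ) =
      (((diff K (next σ)).restrictScalars K).comp (ofComb K (homotopy (next σ))) +
        (ofComb K (homotopy σ)).comp ((diff K σ).restrictScalars K)).comp
          (termProj K (next σ)) := by
    refine ext_basisVec K fun x => ?_
    rw [LinearMap.comp_apply, termProj_basisVec]
    split_ifs with h
    · have h1 := eval_eq_zero K _ (homotopy_identity σ x.1 _ h x.2 rfl)
      have hc : (((-1 : ℤ), x.1, x.2).1 : K) = -1 := by simp
      rw [eval_cons, eval_append, hc] at h1
      have hn : basisVec K x + (-1 : K) • basisVec K x = 0 := by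
        conv_lhs => arg 1; rw [← one_smul K (basisVec K x)]
        rw [← add_smul, add_neg_cancel, zero_smul]
      replace h1 := congrArg (basisVec K x + ·) h1
      dsimp only at h1
      rw [add_zero, ← add_assoc, hn, zero_add] at h1
      refine h1.symm.trans ?_
      refine congrArg₂ (· + ·) (Eq.symm ?_) (Eq.symm ?_)
      · exact (congrArg (diff K (next σ)) (ofComb_basisVec K (homotopy (next σ)) x)).trans
          (map_eval K ((diff K (next σ)).restrictScalars K) _ (diff_basisVec K (next σ)) _)
      · exact (congrArg (ofComb K (homotopy σ)) (diff_basisVec K σ x)).trans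
          (map_eval K (ofComb K (homotopy σ)) _ (ofComb_basisVec K _) _)
    · rw [map_zero]
  have h := LinearMap.congr_fun key f
  rwa [LinearMap.comp_apply, termProj_eq_self K _ hf] at h

/-- The differential of the complexes. -/
noncomputable def termDiff (σ : Pos) : term K (next σ) →ₗ[Alg K 1] term K σ :=
  ((diff K σ).comp (term K (next σ)).subtype).codRestrict _ fun x => diff_mem K σ x

theorem coe_termDiff (σ : Pos) (x : term K (next σ)) : (termDiff K σ x).1 = diff K σ x.1 := rfl

theorem range_termDiff (σ : Pos) :
    LinearMap.range (termDiff K (next σ)) = LinearMap.ker (termDiff K σ) := by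
  ext x
  constructor
  · rintro ⟨y, rfl⟩
    exact Subtype.ext (diff_diff K σ y.1)
  · intro hx
    have h0 : diff K σ x.1 = 0 := congrArg Subtype.val hx
    refine ⟨⟨_, termProj_mem K _ (ofComb K (homotopy (next σ)) x.1)⟩, Subtype.ext ?_⟩
    rw [coe_termDiff, diff_termProj]
    have h := eq_diff_homotopy_add K σ x.2
    rw [h0, map_zero, add_zero] at h
    exact h.symm

/-- The coordinate functions of a term. -/
noncomputable def termCoord (σ : Pos) (l : Fin 2) : term K σ →ₗ[Alg K 1] Alg K 1 :=
  (LinearMap.proj l).comp (term K σ).subtype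

/-- The generators of a term. -/
noncomputable def termGen (σ : Pos) (l : Fin 2) : term K σ :=
  ⟨Pi.single l (idem K σ l), fun m => by
    by_cases h : m = l
    · subst h; rw [Pi.single_eq_same, idem_mul_self]
    · rw [Pi.single_eq_of_ne h, zero_mul]⟩

theorem sum_termCoord_smul (σ : Pos) (x : term K σ) :
    ∑ l, termCoord K σ l x • termGen K σ l = x := by
  refine Subtype.ext (funext fun m => ?_)
  rw [AddSubmonoidClass.coe_finsetSum, Finset.sum_apply, Finset.sum_eq_single m]
  · change x.1 m * (Pi.single m (idem K σ m) : Fin 2 → Alg K 1) m = _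
    rw [Pi.single_eq_same]
    exact x.2 m
  · intro l _ hl
    change x.1 l * (Pi.single l (idem K σ l) : Fin 2 → Alg K 1) m = _
    rw [Pi.single_eq_of_ne hl.symm, mul_zero]
  · exact fun h => absurd (Finset.mem_univ _) h

theorem semiInv_apply {i : Fin 6} {σ : Pos} {φ : term K σ →ₗ[K] K}
    (hφ : φ ∈ Dual.semiInv (vchar K i) (term K σ)) (x : term K σ) :
    φ x = ∑ l, vchar K i (x.1 l) * φ (termGen K σ l) := by
  conv_lhs => rw [← sum_termCoord_smul K σ x]
  rw [map_sum]
  exact Finset.sum_congr rfl fun l _ => hφ _ _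

theorem vchar_pathElem_of_le (i : Fin 6) (p : Pth) (h : 6 ≤ p.val) :
    vchar K i (pathElem K p) = 0 := by
  rw [vchar_pathElem, if_neg]
  rintro rfl
  exact absurd i.isLt (not_lt.2 h)

theorem vchar_eval_row (i : Fin 6) (σ : Pos) (l m : Fin 2) :
    vchar K i (eval K (row σ l) m) = 0 := by
  let g : (Fin 2 → Alg K 1) →ₗ[K] K := (vchar K i).toLinearMap.comp (LinearMap.proj m)
  change g (eval K (row σ l)) = 0
  rw [eval, map_list_sum, List.map_map]
  refine List.sum_eq_zero fun n hn => ?_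
  obtain ⟨t, ht, rfl⟩ := List.mem_map.1 hn
  rw [Function.comp_apply, map_smul]
  refine (congrArg _ ?_).trans (smul_zero _)
  change vchar K i (basisVec K t.2 m) = 0
  rw [basisVec]
  by_cases h : m = t.2.1
  · rw [h, Pi.single_eq_same, vchar_pathElem_of_le K i _ (mem_row σ l t ht).2.2]
  · rw [Pi.single_eq_of_ne h, map_zero]

theorem semiInv_termDiff {i : Fin 6} {σ : Pos} {φ : term K σ →ₗ[K] K}
    (hφ : φ ∈ Dual.semiInv (vchar K i) (term K σ)) (x : term K (next σ)) :
    φ (termDiff K σ x) = 0 := by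
  rw [semiInv_apply K hφ]
  refine Finset.sum_eq_zero fun m _ => ?_
  rw [coe_termDiff, diff_apply, Finset.sum_apply, map_sum, Finset.sum_eq_zero, zero_mul]
  intro l _
  rw [Pi.smul_apply, smul_eq_mul, map_mul, vchar_eval_row, mul_zero]

/-- The semi-invariant functionals on a term. -/
noncomputable def semiInvEquiv (i : Fin 6) (σ : Pos) :
    Dual.semiInv (vchar K i) (term K σ) ≃ₗ[K] ({l // vtx σ l = some i} → K) where
  toFun φ l := φ.1 (termGen K σ l.1)
  map_add' _ _ := rfl
  map_smul' _ _ := rfl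
  invFun g := ⟨∑ l : {l // vtx σ l = some i}, g l • (vchar K i).toLinearMap.comp
      ((termCoord K σ l.1).restrictScalars K), by
    intro a x
    rw [LinearMap.sum_apply, LinearMap.sum_apply, Finset.mul_sum]
    refine Finset.sum_congr rfl fun l _ => ?_
    change g l * vchar K i (a * x.1 l.1) = vchar K i a * (g l * vchar K i (x.1 l.1))
    rw [map_mul]; ring⟩
  left_inv φ := by
    refine Subtype.ext (LinearMap.ext fun x => ?_)
    rw [semiInv_apply K φ.2 x]
    change (∑ l : {l // vtx σ l = some i}, φ.1 (termGen K σ l.1) • (vchar K i).toLinearMap.comp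
      ((termCoord K σ l.1).restrictScalars K)) x = _
    rw [LinearMap.sum_apply]
    change ∑ l : {l // vtx σ l = some i}, φ.1 (termGen K σ l.1) * vchar K i (x.1 l.1) = _
    rw [← Finset.sum_filter_add_sum_filter_not Finset.univ fun l => vtx σ l = some i,
      Finset.sum_eq_zero (s := Finset.univ.filter fun l => ¬vtx σ l = some i), add_zero]
    · rw [Finset.sum_subtype (p := fun l => vtx σ l = some i) _ (by simp)]
      exact Finset.sum_congr rfl fun l _ => mul_comm _ _
    · intro l hl
      rw [← x.2 l, map_mul, vchar_idem, if_neg (Finset.mem_filter.1 hl).2, mul_zero, zero_mul]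
  right_inv g := by
    funext l
    change (∑ m : {m // vtx σ m = some i}, g m • (vchar K i).toLinearMap.comp
      ((termCoord K σ m.1).restrictScalars K)) (termGen K σ l.1) = _
    rw [LinearMap.sum_apply, Finset.sum_eq_single l]
    · change g l * vchar K i ((Pi.single l.1 (idem K σ l.1) : Fin 2 → Alg K 1) l.1) = g l
      rw [Pi.single_eq_same, vchar_idem, if_pos l.2, mul_one]
    · intro m _ hm
      change g m * vchar K i ((Pi.single l.1 (idem K σ l.1) : Fin 2 → Alg K 1) m.1) = 0
      rw [Pi.single_eq_of_ne fun h => hm (Subtype.ext h), map_zero, mul_zero]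
    · exact fun h => absurd (Finset.mem_univ _) h

theorem smul_basisVec_loop (j : Fin 6) (l : Fin 2) (a : Alg K 1) :
    a • basisVec K (l, loop j) = vchar K j a • basisVec K (l, loop j) := by
  let f : Alg K 1 →ₗ[K] (Fin 2 → Alg K 1) :=
    (LinearMap.toSpanSingleton (Alg K 1) _ (basisVec K (l, loop j))).restrictScalars K
  let g : Alg K 1 →ₗ[K] (Fin 2 → Alg K 1) :=
    (LinearMap.toSpanSingleton K _ (basisVec K (l, loop j))).comp (vchar K j).toLinearMap
  have h : f = g := (pathBasis K).ext fun p => by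
    rw [pathBasis_apply]
    change pathElem K p • basisVec K (l, loop j) =
      vchar K j (pathElem K p) • basisVec K (l, loop j)
    rw [pathElem_smul_basisVec, vchar_pathElem, pathMul_loop]
    split_ifs
    · exact (one_smul _ _).symm
    · exact (zero_smul _ _).symm
  exact LinearMap.congr_fun h a

theorem basisVec_ne_zero (x : Fin 2 × Pth) : basisVec K x ≠ 0 := fun h => by
  have h0 := congrFun h x.1
  rw [basisVec, Pi.single_eq_same, ← pathBasis_apply] at h0
  exact (pathBasis K).ne_zero _ h0

theorem diff_before (j : Fin 6) (f : Fin 2 → Alg K 1) :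
    diff K (before j) f = vchar K j (f 0) • basisVec K (0, loop j) := by
  have hc : (((1 : ℤ), (0 : Fin 2), loop j).1 : K) = 1 := by simp
  rw [diff_apply, Fin.sum_univ_two, (row_before j).1, (row_before j).2, eval_nil, smul_zero,
    add_zero, eval_cons, eval_nil, add_zero, hc, one_smul]
  exact smul_basisVec_loop K j 0 (f 0)

/-- The augmentation from a term to the simple module at a vertex. -/
noncomputable def aug (j : Fin 6) (σ : Pos) : term K σ →ₗ[Alg K 1] Chr (vchar K j) where
  toFun x := vchar K j (x.1 0)
  map_add' x y := map_add (vchar K j) (x.1 0) (y.1 0)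
  map_smul' a x := map_mul (vchar K j) a (x.1 0)

theorem ker_aug (j : Fin 6) :
    LinearMap.ker (aug K j (start j)) = LinearMap.range (termDiff K (start j)) := by
  rw [← next_before, range_termDiff]
  ext x
  have h : (termDiff K (before j) x).1 = vchar K j (x.1 0) • basisVec K (0, loop j) :=
    diff_before K j x.1
  rw [LinearMap.mem_ker, LinearMap.mem_ker, ← Submodule.coe_eq_zero, h]
  exact (smul_eq_zero_iff_left (M := Fin 2 → Alg K 1) (basisVec_ne_zero K (0, loop j))
    (r := vchar K j (x.1 0))).symm

theorem aug_surjective (j : Fin 6) : Function.Surjective (aug K j (start j)) := fun (c : K) => by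
  refine ⟨algebraMap K (Alg K 1) c • termGen K (start j) 0, ?_⟩
  change vchar K j (algebraMap K (Alg K 1) c *
    (Pi.single 0 (idem K (start j) 0) : Fin 2 → Alg K 1) 0) = c
  rw [Pi.single_eq_same, map_mul, vchar_idem, if_pos (vtx_start j).1, mul_one]
  exact (vchar K j).commutes c

theorem rank_hom_dual_chr (res : ProjRes (Env K 1) (Alg K 1)) (hmin : res.Minimal) (i j : Fin 6)
    (t : ℕ) : Module.rank K (res.Q t →ₗ[Env K 1] Dual (vchar K i) (Chr (vchar K j))) =
      ((Finset.univ.filter fun l => vtx (orbit (start j) t) l = some i).card : Cardinal) := by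
  obtain ⟨e⟩ := nonempty_cohomology_equiv_hom (k := K) (N := Dual (vchar K i) (Chr (vchar K j))) res
    hmin (fun r hr x => jacobson_smul_dual_chr _ _ r hr x) t
  let d : ∀ k, term K (orbit (start j) (k + 1)) →ₗ[Alg K 1] term K (orbit (start j) k) :=
    fun k => termDiff K (orbit (start j) k)
  have h := nonempty_cohomology_equiv_semiInv res (vchar K i)
    (P := fun k => term K (orbit (start j) k)) d
  obtain ⟨e'⟩ := h (fun k => range_termDiff K _) (fun k => termCoord K _) (fun k => termGen K _)
    (fun k => sum_termCoord_smul K _) (fun k φ hφ x => semiInv_termDiff K hφ x) t 0 t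
    (Nat.zero_add t).symm (aug K j (start j)) (aug_surjective K j) (ker_aug K j)
  rw [(e.symm.trans (e'.trans (semiInvEquiv K i _))).rank_eq, rank_fun', Fintype.card_subtype]

end Complexes

/-- Dimensions of the homomorphism groups `Hom_Λ(Q_t, R_1)` for the
minimal projective `Λ`-resolution `(Q_t)` of `R_1` (case `s = 1`). -/
theorem hom_dims_one (K : Type u) [Field K]
    (res : ProjRes (Env K 1) (Alg K 1)) (hmin : res.Minimal) (t : ℕ) :
    Module.finrank K (res.Q t →ₗ[Env K 1] Alg K 1) = homDim1 t := by
  have := res.proj t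
  refine Module.finrank_eq_of_rank_eq ?_
  rw [rank_hom_alg, homDim1_mod, ← sum_vtx_eq_homDim1 ⟨t % 22, Nat.mod_lt t (by norm_num)⟩,
    Nat.cast_sum]
  refine Finset.sum_congr rfl fun p _ => ?_
  rw [rank_hom_dual_chr K res hmin, orbit_mod]

end E6
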